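/- The thick idempotent e_{λ_k} is a primitive idempotent of R_m(Q̄_{C̃}): e_{λ_k} ≠ 0, and there do not exist nonzero idempotents f, g ∈ R_m(Q̄_{C̃}) with fg = gf = 0 and e_{λ_k} = f + g. -/

import Mathlib

open Classical
open scoped BigOperators

noncomputable section

/-- A Cartan datum on a finite index set `I`: a symmetric bilinear form with
`i·i ∈ 2ℤ_{>0}` and `2(i·j)/(i·i)` a nonpositive integer for `i ≠ j`. -/
structure CartanDatum (I : Type) [Fintype I] where
  form : I → I → ℤ
  symm : ∀ i j, form i j = form j i
  diag_even : ∀ i, Even (form i i)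
  diag_pos : ∀ i, 0 < form i i
  off_dvd : ∀ i j, i ≠ j → form i i ∣ 2 * form i j
  off_nonpos : ∀ i j, i ≠ j → 2 * form i j ≤ 0

/-- The bilinear form of the extended Cartan datum on `Ĩ = I ⊔ Ī`
(`Sum.inl` is `I`, `Sum.inr` is `Ī`). -/
def extForm {I : Type} [Fintype I] (C : CartanDatum I) : I ⊕ I → I ⊕ I → ℤ
  | Sum.inl i, Sum.inl j => C.form i j
  | Sum.inl i, Sum.inr j => if j = i then -(C.form i i / 2) else 0
  | Sum.inr i, Sum.inl j => if j = i then -(C.form i i / 2) else 0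
  | Sum.inr i, Sum.inr j => if i = j then C.form i i else 0

/-- Generators of the KLR algebra on `n` strands labelled by `J`:
idempotents `e 𝐢`, dots `x j`, crossings `psi j` (crossing strands `j, j+1`, 0-indexed). -/
inductive KLRGen (J : Type) (n : ℕ) : Type
  | e : (Fin n → J) → KLRGen J n
  | x : Fin n → KLRGen J n
  | psi : Fin (n - 1) → KLRGen J n

/-- The left strand position of the crossing `ψ_j`. -/
def lpos {n : ℕ} (j : Fin (n - 1)) : Fin n := Fin.castLE (n.sub_le 1) j

/-- The right strand position of the crossing `ψ_j`. -/
def rpos {n : ℕ} (j : Fin (n - 1)) : Fin n :=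
  ⟨j.val + 1, by have := j.isLt; omega⟩

/-- The generator `e(𝐢)` of the free algebra. -/
def Ef (𝕜 : Type) [Field 𝕜] (J : Type) (n : ℕ) (i : Fin n → J) :
    FreeAlgebra 𝕜 (KLRGen J n) :=
  FreeAlgebra.ι 𝕜 (KLRGen.e i)

/-- The generator `x_j` of the free algebra. -/
def Xf (𝕜 : Type) [Field 𝕜] (J : Type) (n : ℕ) (j : Fin n) :
    FreeAlgebra 𝕜 (KLRGen J n) :=
  FreeAlgebra.ι 𝕜 (KLRGen.x j)

/-- The generator `ψ_j` of the free algebra. -/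
def Pf (𝕜 : Type) [Field 𝕜] (J : Type) (n : ℕ) (j : Fin (n - 1)) :
    FreeAlgebra 𝕜 (KLRGen J n) :=
  FreeAlgebra.ι 𝕜 (KLRGen.psi j)

/-- The Cartan integer `c(a,b) = 2(a·b)/(a·a)`. -/
def cB {J : Type} (B : J → J → ℤ) (a b : J) : ℤ := 2 * B a b / B a a

/-- A bound such that any `p` with `s^{pq}(a,b) ≠ 0` satisfies `p < sBound B a b`. -/
def sBound {J : Type} (B : J → J → ℤ) (a b : J) : ℕ := (-(B a b)).toNat + 1

/-- The term `Σ_{p,q} s^{pq}(a,b) x_j^p x_{j'}^q`. -/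
def psiSqS (𝕜 : Type) [Field 𝕜] (J : Type) (n : ℕ) (B : J → J → ℤ)
    (s : J → J → ℕ → ℕ → 𝕜) (a b : J) (j j' : Fin n) :
    FreeAlgebra 𝕜 (KLRGen J n) :=
  ∑ p ∈ Finset.range (sBound B a b), ∑ q ∈ Finset.range (sBound B a b),
    s a b p q • (Xf 𝕜 J n j ^ p * Xf 𝕜 J n j' ^ q)

/-- The defining relations of the KLR algebra `R_n` associated with the form `B`
and scalar parameters `t`, `r`, `s`. -/
inductive KLRRel (𝕜 : Type) [Field 𝕜] (J : Type) [Fintype J] (n : ℕ)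
    (B : J → J → ℤ) (t : J → J → 𝕜) (r : J → 𝕜) (s : J → J → ℕ → ℕ → 𝕜) :
    FreeAlgebra 𝕜 (KLRGen J n) → FreeAlgebra 𝕜 (KLRGen J n) → Prop
  | ee (i j : Fin n → J) :
      KLRRel 𝕜 J n B t r s (Ef 𝕜 J n i * Ef 𝕜 J n j)
        (if i = j then Ef 𝕜 J n i else 0)
  | esum :
      KLRRel 𝕜 J n B t r s (∑ i : Fin n → J, Ef 𝕜 J n i) 1
  | xe (j : Fin n) (i : Fin n → J) :
      KLRRel 𝕜 J n B t r s (Xf 𝕜 J n j * Ef 𝕜 J n i) (Ef 𝕜 J n i * Xf 𝕜 J n j)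
  | psie (j : Fin (n - 1)) (i : Fin n → J) :
      KLRRel 𝕜 J n B t r s (Pf 𝕜 J n j * Ef 𝕜 J n i)
        (Ef 𝕜 J n (i ∘ Equiv.swap (lpos j) (rpos j)) * Pf 𝕜 J n j)
  | xx (j k : Fin n) :
      KLRRel 𝕜 J n B t r s (Xf 𝕜 J n j * Xf 𝕜 J n k) (Xf 𝕜 J n k * Xf 𝕜 J n j)
  | psix (j : Fin (n - 1)) (k : Fin n) (h1 : k ≠ lpos j) (h2 : k ≠ rpos j) :
      KLRRel 𝕜 J n B t r s (Pf 𝕜 J n j * Xf 𝕜 J n k) (Xf 𝕜 J n k * Pf 𝕜 J n j)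
  | psipsi (j k : Fin (n - 1)) (h : (j : ℕ) + 1 < (k : ℕ)) :
      KLRRel 𝕜 J n B t r s (Pf 𝕜 J n j * Pf 𝕜 J n k) (Pf 𝕜 J n k * Pf 𝕜 J n j)
  | dot1 (j : Fin (n - 1)) (i : Fin n → J) :
      KLRRel 𝕜 J n B t r s
        (Xf 𝕜 J n (lpos j) * Pf 𝕜 J n j * Ef 𝕜 J n i
          - Pf 𝕜 J n j * Xf 𝕜 J n (rpos j) * Ef 𝕜 J n i)
        (if i (lpos j) = i (rpos j) then r (i (lpos j)) • Ef 𝕜 J n i else 0)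
  | dot2 (j : Fin (n - 1)) (i : Fin n → J) :
      KLRRel 𝕜 J n B t r s
        (Pf 𝕜 J n j * Xf 𝕜 J n (lpos j) * Ef 𝕜 J n i
          - Xf 𝕜 J n (rpos j) * Pf 𝕜 J n j * Ef 𝕜 J n i)
        (if i (lpos j) = i (rpos j) then r (i (lpos j)) • Ef 𝕜 J n i else 0)
  | psisq (j : Fin (n - 1)) (i : Fin n → J) :
      KLRRel 𝕜 J n B t r s (Pf 𝕜 J n j * Pf 𝕜 J n j * Ef 𝕜 J n i)
        (if i (lpos j) = i (rpos j) then 0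
         else if B (i (lpos j)) (i (rpos j)) = 0 then
           t (i (lpos j)) (i (rpos j)) • Ef 𝕜 J n i
         else
           (t (i (lpos j)) (i (rpos j)) •
              (Xf 𝕜 J n (lpos j) ^ (-(cB B (i (lpos j)) (i (rpos j)))).toNat)
            + t (i (rpos j)) (i (lpos j)) •
              (Xf 𝕜 J n (rpos j) ^ (-(cB B (i (rpos j)) (i (lpos j)))).toNat)
            + psiSqS 𝕜 J n B s (i (lpos j)) (i (rpos j)) (lpos j) (rpos j))
           * Ef 𝕜 J n i)
  | braid (j k : Fin (n - 1)) (h : (j : ℕ) + 1 = (k : ℕ)) (i : Fin n → J) :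
      KLRRel 𝕜 J n B t r s
        (Pf 𝕜 J n j * Pf 𝕜 J n k * Pf 𝕜 J n j * Ef 𝕜 J n i
          - Pf 𝕜 J n k * Pf 𝕜 J n j * Pf 𝕜 J n k * Ef 𝕜 J n i)
        (if i (lpos j) = i (rpos k) ∧ cB B (i (lpos j)) (i (rpos j)) + 1 ≤ 0 then
          (r (i (lpos j)) * t (i (lpos j)) (i (rpos j))) •
            (∑ d ∈ Finset.range ((-(cB B (i (lpos j)) (i (rpos j))) - 1).toNat + 1),
              Xf 𝕜 J n (lpos j) ^ d
                * Xf 𝕜 J n (rpos k) ^ ((-(cB B (i (lpos j)) (i (rpos j))) - 1).toNat - d)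
                * Ef 𝕜 J n i)
          + r (i (lpos j)) •
            (∑ p ∈ Finset.range (sBound B (i (lpos j)) (i (rpos j))),
             ∑ q ∈ Finset.range (sBound B (i (lpos j)) (i (rpos j))),
              s (i (lpos j)) (i (rpos j)) p q •
                ∑ k1 ∈ Finset.range p,
                  Xf 𝕜 J n (lpos j) ^ k1 * Xf 𝕜 J n (rpos j) ^ q
                    * Xf 𝕜 J n (rpos k) ^ (p - 1 - k1) * Ef 𝕜 J n i)
         else 0)

/-- The KLR algebra `R_n` on `n` strands. -/
abbrev KLRAlg (𝕜 : Type) [Field 𝕜] (J : Type) [Fintype J] (n : ℕ)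
    (B : J → J → ℤ) (t : J → J → 𝕜) (r : J → 𝕜) (s : J → J → ℕ → ℕ → 𝕜) :=
  RingQuot (KLRRel 𝕜 J n B t r s)

/-- The canonical map from the free algebra to the KLR algebra. -/
def klrMk (𝕜 : Type) [Field 𝕜] (J : Type) [Fintype J] (n : ℕ)
    (B : J → J → ℤ) (t : J → J → 𝕜) (r : J → 𝕜) (s : J → J → ℕ → ℕ → 𝕜) :
    FreeAlgebra 𝕜 (KLRGen J n) →ₐ[𝕜] KLRAlg 𝕜 J n B t r s :=
  RingQuot.mkAlgHom 𝕜 (KLRRel 𝕜 J n B t r s)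

/-- The idempotent `e(𝐢)` in the KLR algebra. -/
def eQ (𝕜 : Type) [Field 𝕜] (J : Type) [Fintype J] (n : ℕ)
    (B : J → J → ℤ) (t : J → J → 𝕜) (r : J → 𝕜) (s : J → J → ℕ → ℕ → 𝕜)
    (i : Fin n → J) : KLRAlg 𝕜 J n B t r s :=
  klrMk 𝕜 J n B t r s (Ef 𝕜 J n i)

/-- The dot `x_j` in the KLR algebra. -/
def xQ (𝕜 : Type) [Field 𝕜] (J : Type) [Fintype J] (n : ℕ)
    (B : J → J → ℤ) (t : J → J → 𝕜) (r : J → 𝕜) (s : J → J → ℕ → ℕ → 𝕜)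
    (j : Fin n) : KLRAlg 𝕜 J n B t r s :=
  klrMk 𝕜 J n B t r s (Xf 𝕜 J n j)

/-- The crossing `ψ_j` in the KLR algebra. -/
def pQ (𝕜 : Type) [Field 𝕜] (J : Type) [Fintype J] (n : ℕ)
    (B : J → J → ℤ) (t : J → J → 𝕜) (r : J → 𝕜) (s : J → J → ℕ → ℕ → 𝕜)
    (j : Fin (n - 1)) : KLRAlg 𝕜 J n B t r s :=
  klrMk 𝕜 J n B t r s (Pf 𝕜 J n j)

section Extended

/-- The list of block labels of the thick strand: the label `i` appears with
multiplicity `λ^{(i)}`, in increasing order of `i`. -/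
def blockList (N : ℕ) (lam : Fin N → ℕ) : List (Fin N) :=
  (List.finRange N).flatMap (fun i => List.replicate (lam i) i)

/-- `m = Σ_i λ^{(i)}`, the total number of dashed strands of the thick strand. -/
def mTot (N : ℕ) (lam : Fin N → ℕ) : ℕ := (blockList N lam).length

/-- The block containing the strand position `l`. -/
def blockOf (N : ℕ) (lam : Fin N → ℕ) (l : Fin (mTot N lam)) : Fin N :=
  (blockList N lam).get l

/-- `psum i = Σ_{a < i} λ^{(a)}`, the starting position of the `i`-th block. -/
def psum (N : ℕ) (lam : Fin N → ℕ) (i : Fin N) : ℕ :=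
  ∑ a : Fin N, if a.val < i.val then lam a else 0

/-- The sequence `μ̄ ∈ Ī^m` listing each `ī` with multiplicity `λ^{(i)}`, in
increasing order of `i`. -/
def mubar (N : ℕ) (lam : Fin N → ℕ) : Fin (mTot N lam) → Fin N ⊕ Fin N :=
  fun l => Sum.inr (blockOf N lam l)

/-- The standard reduced word `s_1 (s_2 s_1) ⋯ (s_{a−1} ⋯ s_1)` (0-indexed) of the
longest element `w_0` of `𝔖_a`. -/
def w0Word (a : ℕ) : List ℕ :=
  (List.range a).flatMap (fun k => (List.range k).reverse)

/-- The KLR algebra `R_n(Q̄_{C̃})` of the extended Cartan datum of `C` with the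
specialized scalar parameters: `r ≡ 1`, `s ≡ 0` and `t` as given. -/
abbrev ExtKLR (𝕜 : Type) [Field 𝕜] (N : ℕ) (C : CartanDatum (Fin N))
    (t : Fin N ⊕ Fin N → Fin N ⊕ Fin N → 𝕜) (n : ℕ) :=
  KLRAlg 𝕜 (Fin N ⊕ Fin N) n (extForm C) t (fun _ => 1) (fun _ _ _ _ => 0)

/-- The dot `x_l` (0-indexed position `l`, junk value `1` if `l ≥ n`). -/
def Xn (𝕜 : Type) [Field 𝕜] (N : ℕ) (C : CartanDatum (Fin N))
    (t : Fin N ⊕ Fin N → Fin N ⊕ Fin N → 𝕜) (n : ℕ) (l : ℕ) :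
    ExtKLR 𝕜 N C t n :=
  if h : l < n then
    xQ 𝕜 (Fin N ⊕ Fin N) n (extForm C) t (fun _ => 1) (fun _ _ _ _ => 0) ⟨l, h⟩
  else 1

/-- The crossing `ψ_l` of the strands at 0-indexed positions `l, l+1`
(junk value `1` if `l ≥ n − 1`). -/
def Pn (𝕜 : Type) [Field 𝕜] (N : ℕ) (C : CartanDatum (Fin N))
    (t : Fin N ⊕ Fin N → Fin N ⊕ Fin N → 𝕜) (n : ℕ) (l : ℕ) :
    ExtKLR 𝕜 N C t n :=
  if h : l < n - 1 then
    pQ 𝕜 (Fin N ⊕ Fin N) n (extForm C) t (fun _ => 1) (fun _ _ _ _ => 0) ⟨l, h⟩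
  else 1

/-- The idempotent `e(𝐢)` of `R_n(Q̄_{C̃})`. -/
def eS (𝕜 : Type) [Field 𝕜] (N : ℕ) (C : CartanDatum (Fin N))
    (t : Fin N ⊕ Fin N → Fin N ⊕ Fin N → 𝕜) (n : ℕ)
    (i : Fin n → Fin N ⊕ Fin N) : ExtKLR 𝕜 N C t n :=
  eQ 𝕜 (Fin N ⊕ Fin N) n (extForm C) t (fun _ => 1) (fun _ _ _ _ => 0) i

/-- The nilHecke idempotent `e_a = x_1^{a−1} ⋯ x_{a−1} ψ_{w_0}` written in the
generators attached to the `a` consecutive strand positions `o, o+1, …, o+a−1`. -/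
def enAt (𝕜 : Type) [Field 𝕜] (N : ℕ) (C : CartanDatum (Fin N))
    (t : Fin N ⊕ Fin N → Fin N ⊕ Fin N → 𝕜) (n o a : ℕ) :
    ExtKLR 𝕜 N C t n :=
  (((List.range a).map (fun d => Xn 𝕜 N C t n (o + d) ^ (a - 1 - d))).prod) *
  (((w0Word a).map (fun l => Pn 𝕜 N C t n (o + l))).prod)

/-- The product `Π_{i ∈ I} e_{λ^{(i)}}` of nilHecke idempotents, the `i`-th one
written in the generators of the `i`-th block of strand positions, the thick
strand occupying the positions `o, o+1, …, o+m−1`. -/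
def nilProd (𝕜 : Type) [Field 𝕜] (N : ℕ) (C : CartanDatum (Fin N))
    (t : Fin N ⊕ Fin N → Fin N ⊕ Fin N → 𝕜) (lam : Fin N → ℕ) (n o : ℕ) :
    ExtKLR 𝕜 N C t n :=
  ((List.finRange N).map (fun i => enAt 𝕜 N C t n (o + psum N lam i) (lam i))).prod

/-- The thick idempotent `e_{λ} = e(μ̄) Π_i e_{λ^{(i)}} ∈ R_m(Q̄_{C̃})`. -/
def thickE (𝕜 : Type) [Field 𝕜] (N : ℕ) (C : CartanDatum (Fin N))
    (t : Fin N ⊕ Fin N → Fin N ⊕ Fin N → 𝕜) (lam : Fin N → ℕ) :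
    ExtKLR 𝕜 N C t (mTot N lam) :=
  eS 𝕜 N C t (mTot N lam) (mubar N lam) * nilProd 𝕜 N C t lam (mTot N lam) 0

/-- The `d`-th elementary symmetric polynomial in the dots `x_l`, `l ∈ S`. -/
def esymAt (𝕜 : Type) [Field 𝕜] (N : ℕ) (C : CartanDatum (Fin N))
    (t : Fin N ⊕ Fin N → Fin N ⊕ Fin N → 𝕜) (n d : ℕ) (S : Finset ℕ) :
    ExtKLR 𝕜 N C t n :=
  ∑ T ∈ S.powersetCard d, ((T.sort (· ≤ ·)).map (Xn 𝕜 N C t n)).prod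

/-- The set of strand positions of the `i`-th block of the thick strand, when the
thick strand occupies the positions `o, o+1, …, o+m−1`. -/
def blkSet (N : ℕ) (lam : Fin N → ℕ) (o : ℕ) (i : Fin N) : Finset ℕ :=
  Finset.Ico (o + psum N lam i) (o + psum N lam i + lam i)

end Extended

section DividedDifference

open MvPolynomial

variable {𝕜 : Type} [Field 𝕜] {σ : Type} [DecidableEq σ]

/-- The transposition of two variables of a polynomial ring. -/
def swapVars (i j : σ) : MvPolynomial σ 𝕜 →ₐ[𝕜] MvPolynomial σ 𝕜 :=
  rename (Equiv.swap i j)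

@[simp]
lemma swapVars_X (i j k : σ) : swapVars i j (X k : MvPolynomial σ 𝕜) = X (Equiv.swap i j k) :=
  rename_X _ _

@[simp]
lemma swapVars_swapVars (i j : σ) (p : MvPolynomial σ 𝕜) :
    swapVars i j (swapVars i j p) = p := by
  simp only [swapVars, rename_rename]
  rw [show (Equiv.swap i j : σ → σ) ∘ Equiv.swap i j = id by ext; simp, rename_id_apply]

lemma swapVars_comm {i j k l : σ} (hik : i ≠ k) (hil : i ≠ l) (hjk : j ≠ k) (hjl : j ≠ l)
    (p : MvPolynomial σ 𝕜) :
    swapVars i j (swapVars k l p) = swapVars k l (swapVars i j p) := by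
  simp only [swapVars, rename_rename]
  congr 2
  ext a
  simp only [Function.comp_apply, Equiv.swap_apply_def]
  grind

lemma swapVars_braid {i j k : σ} (hij : i ≠ j) (hik : i ≠ k) (hjk : j ≠ k)
    (p : MvPolynomial σ 𝕜) :
    swapVars i j (swapVars j k (swapVars i j p)) =
      swapVars j k (swapVars i j (swapVars j k p)) := by
  simp only [swapVars, rename_rename]
  congr 2
  ext a
  simp only [Function.comp_apply, Equiv.swap_apply_def]
  grind

lemma X_sub_X_dvd_sub_swapVars (i j : σ) (p : MvPolynomial σ 𝕜) :
    (X i - X j) ∣ p - swapVars i j p := by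
  induction p using MvPolynomial.induction_on with
  | C a => simp [swapVars]
  | add p q hp hq =>
    rw [map_add, add_sub_add_comm]
    exact dvd_add hp hq
  | mul_X p k hp =>
    have hk : (X i - X j : MvPolynomial σ 𝕜) ∣ X k - X (Equiv.swap i j k) := by
      rw [Equiv.swap_apply_def]
      split_ifs with h1 h2
      · subst h1; exact dvd_rfl
      · subst h2; exact (dvd_neg.mpr dvd_rfl).trans (by rw [neg_sub])
      · simp
    rw [map_mul, swapVars_X, show p * X k - swapVars i j p * X (Equiv.swap i j k) =
      (p - swapVars i j p) * X k + swapVars i j p * (X k - X (Equiv.swap i j k)) by ring]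
    exact dvd_add (hp.mul_right _) (hk.mul_left _)

lemma X_sub_X_ne_zero {τ : Type} {i j : τ} (h : i ≠ j) : (X i - X j : MvPolynomial τ 𝕜) ≠ 0 :=
  sub_ne_zero.mpr fun h' => h (X_injective h')

/-- The divided difference operator `p ↦ (p - s p) / (X i - X j)`. -/
def divDiff (i j : σ) (h : i ≠ j) : MvPolynomial σ 𝕜 →ₗ[𝕜] MvPolynomial σ 𝕜 where
  toFun p := (X_sub_X_dvd_sub_swapVars i j p).choose
  map_add' p q := by
    apply mul_left_cancel₀ (X_sub_X_ne_zero (𝕜 := 𝕜) h)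
    rw [mul_add, ← (X_sub_X_dvd_sub_swapVars i j (p + q)).choose_spec,
      ← (X_sub_X_dvd_sub_swapVars i j p).choose_spec,
      ← (X_sub_X_dvd_sub_swapVars i j q).choose_spec, map_add]
    ring
  map_smul' c p := by
    apply mul_left_cancel₀ (X_sub_X_ne_zero (𝕜 := 𝕜) h)
    rw [RingHom.id_apply, mul_smul_comm, ← (X_sub_X_dvd_sub_swapVars i j (c • p)).choose_spec,
      ← (X_sub_X_dvd_sub_swapVars i j p).choose_spec, map_smul, smul_sub]

lemma mul_divDiff {i j : σ} (h : i ≠ j) (p : MvPolynomial σ 𝕜) :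
    (X i - X j) * divDiff i j h p = p - swapVars i j p :=
  (X_sub_X_dvd_sub_swapVars i j p).choose_spec.symm

lemma divDiff_eq {i j : σ} (h : i ≠ j) {p q : MvPolynomial σ 𝕜}
    (hq : (X i - X j) * q = p - swapVars i j p) : divDiff i j h p = q :=
  mul_left_cancel₀ (X_sub_X_ne_zero h) ((mul_divDiff h p).trans hq.symm)

lemma divDiff_mul {i j : σ} (h : i ≠ j) (p q : MvPolynomial σ 𝕜) :
    divDiff i j h (p * q) = divDiff i j h p * swapVars i j q + p * divDiff i j h q := by
  apply divDiff_eq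
  rw [map_mul]
  linear_combination swapVars i j q * mul_divDiff h p + p * mul_divDiff h q

lemma divDiff_eq_zero {i j : σ} (h : i ≠ j) {p : MvPolynomial σ 𝕜}
    (hp : swapVars i j p = p) : divDiff i j h p = 0 :=
  divDiff_eq h (by rw [hp]; ring)

@[simp]
lemma divDiff_C {i j : σ} (h : i ≠ j) (a : 𝕜) : divDiff i j h (C a) = 0 :=
  divDiff_eq_zero h (by simp [swapVars])

@[simp]
lemma divDiff_X_left {i j : σ} (h : i ≠ j) : divDiff i j h (X i : MvPolynomial σ 𝕜) = 1 :=
  divDiff_eq h (by simp)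

@[simp]
lemma divDiff_X_right {i j : σ} (h : i ≠ j) : divDiff i j h (X j : MvPolynomial σ 𝕜) = -1 :=
  divDiff_eq h (by simp)

lemma divDiff_X_of_ne {i j k : σ} (h : i ≠ j) (hi : k ≠ i) (hj : k ≠ j) :
    divDiff i j h (X k : MvPolynomial σ 𝕜) = 0 :=
  divDiff_eq_zero h (by simp [Equiv.swap_apply_of_ne_of_ne hi hj])

lemma swapVars_divDiff {i j : σ} (h : i ≠ j) (p : MvPolynomial σ 𝕜) :
    swapVars i j (divDiff i j h p) = divDiff i j h p := by
  have := congrArg (swapVars i j) (mul_divDiff h p)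
  simp only [map_mul, map_sub, swapVars_X, Equiv.swap_apply_left, Equiv.swap_apply_right,
    swapVars_swapVars] at this
  exact (divDiff_eq h (by linear_combination -this)).symm

lemma divDiff_divDiff {i j : σ} (h : i ≠ j) (p : MvPolynomial σ 𝕜) :
    divDiff i j h (divDiff i j h p) = 0 :=
  divDiff_eq_zero h (swapVars_divDiff h p)

lemma divDiff_swapVars_comm {i j k l : σ} (h : i ≠ j) (hik : i ≠ k) (hil : i ≠ l)
    (hjk : j ≠ k) (hjl : j ≠ l) (p : MvPolynomial σ 𝕜) :
    divDiff i j h (swapVars k l p) = swapVars k l (divDiff i j h p) := by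
  apply divDiff_eq
  have := congrArg (swapVars k l) (mul_divDiff h p)
  simp only [map_mul, map_sub, swapVars_X, Equiv.swap_apply_of_ne_of_ne hik hil,
    Equiv.swap_apply_of_ne_of_ne hjk hjl] at this
  rw [this, swapVars_comm hik hil hjk hjl]

lemma divDiff_comm {i j k l : σ} (h : i ≠ j) (h' : k ≠ l) (hik : i ≠ k) (hil : i ≠ l)
    (hjk : j ≠ k) (hjl : j ≠ l) (p : MvPolynomial σ 𝕜) :
    divDiff i j h (divDiff k l h' p) = divDiff k l h' (divDiff i j h p) := by
  apply divDiff_eq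
  apply mul_left_cancel₀ (X_sub_X_ne_zero (𝕜 := 𝕜) h')
  have h1 := mul_divDiff h' (divDiff i j h p)
  have h2 := divDiff_swapVars_comm h' hik.symm hjk.symm hil.symm hjl.symm p
  have h3 := divDiff_swapVars_comm h hik hil hjk hjl p
  have h4 := mul_divDiff h p
  have h5 := mul_divDiff h (swapVars k l p)
  have h6 := mul_divDiff h' p
  have h7 := mul_divDiff h' (swapVars i j p)
  rw [← h2, ← swapVars_comm hik hil hjk hjl] at *
  rw [h3] at h5
  linear_combination (X i - X j) * h1 + h4 - h5 - h6 + h7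

lemma divDiff_braid {i j k : σ} (hij : i ≠ j) (hik : i ≠ k) (hjk : j ≠ k)
    (p : MvPolynomial σ 𝕜) :
    divDiff i j hij (divDiff j k hjk (divDiff i j hij p)) =
      divDiff j k hjk (divDiff i j hij (divDiff j k hjk p)) := by
  have e1 : Equiv.swap i j k = k := Equiv.swap_apply_of_ne_of_ne hik.symm hjk.symm
  have e2 : Equiv.swap j k i = i := Equiv.swap_apply_of_ne_of_ne hij hik
  apply mul_left_cancel₀ (X_sub_X_ne_zero (𝕜 := 𝕜) hij)
  apply mul_left_cancel₀ (X_sub_X_ne_zero (𝕜 := 𝕜) hjk)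
  apply mul_left_cancel₀ (X_sub_X_ne_zero (𝕜 := 𝕜) hik)
  have a1 := mul_divDiff hij p
  have a2 := mul_divDiff hjk (divDiff i j hij p)
  have a3 := mul_divDiff hij (divDiff j k hjk (divDiff i j hij p))
  have b1 := mul_divDiff hjk p
  have b2 := mul_divDiff hij (divDiff j k hjk p)
  have b3 := mul_divDiff hjk (divDiff i j hij (divDiff j k hjk p))
  have a2' := congrArg (swapVars i j) a2
  have a1' := congrArg (swapVars j k) a1
  have a1'' := congrArg (swapVars i j) a1'
  have b2' := congrArg (swapVars j k) b2
  have b1' := congrArg (swapVars i j) b1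
  have b1'' := congrArg (swapVars j k) b1'
  simp only [map_mul, map_sub, swapVars_X, Equiv.swap_apply_left, Equiv.swap_apply_right,
    swapVars_divDiff, e1, e2] at a2' a1' a1'' b2' b1' b1''
  have hb := swapVars_braid hij hik hjk p
  linear_combination (X i - X k) * (X j - X k) * a3 + (X i - X k) * a2 - (X j - X k) * a2' + a1
    - a1' + a1'' - ((X i - X k) * (X i - X j) * b3 + (X i - X k) * b2 - (X i - X j) * b2' + b1
    - b1' + b1'') - hb

end DividedDifference

section PolynomialRepresentation

open MvPolynomial

lemma lpos_ne_rpos {n : ℕ} (j : Fin (n - 1)) : lpos j ≠ rpos j := by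
  simp [lpos, rpos, Fin.ext_iff]

lemma lpos_lt_rpos {n : ℕ} (j : Fin (n - 1)) : lpos j < rpos j := by
  simp [lpos, rpos, Fin.lt_def]

lemma lpos_ne_lpos {n : ℕ} {j k : Fin (n - 1)} (h : (j : ℕ) ≠ k) : lpos j ≠ lpos k := by
  simpa [lpos, Fin.ext_iff] using h

lemma rpos_ne_rpos {n : ℕ} {j k : Fin (n - 1)} (h : (j : ℕ) ≠ k) : rpos j ≠ rpos k := by
  simpa [rpos, Fin.ext_iff] using h

lemma lpos_ne_rpos_of {n : ℕ} {j k : Fin (n - 1)} (h : (j : ℕ) ≠ k + 1) : lpos j ≠ rpos k := by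
  simpa [lpos, rpos, Fin.ext_iff] using h

lemma rpos_eq_lpos {n : ℕ} {j k : Fin (n - 1)} (h : (j : ℕ) + 1 = k) : rpos j = lpos k := by
  simpa [lpos, rpos, Fin.ext_iff] using h

lemma extForm_inr_of_ne {N : ℕ} (C : CartanDatum (Fin N)) {a b : Fin N} (h : a ≠ b) :
    extForm C (Sum.inr a) (Sum.inr b) = 0 := by
  simp [extForm, h]

lemma not_cB_extForm_inr_add_one_nonpos {N : ℕ} (C : CartanDatum (Fin N)) (a b : Fin N) :
    ¬ cB (extForm C) (Sum.inr a) (Sum.inr b) + 1 ≤ 0 := by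
  by_cases h : a = b
  · subst h
    simp only [cB, extForm, if_true]
    rw [Int.mul_ediv_cancel _ (C.diag_pos a).ne']
    norm_num
  · simp [cB, extForm, h]

variable (𝕜 : Type) [Field 𝕜] (N n : ℕ)

/-- The space of the right polynomial representation: one copy of the polynomial ring for each
sequence of dashed labels. -/
abbrev PolySpace := (Fin n → Fin N) → MvPolynomial (Fin n) 𝕜

/-- The right action of the generators on the polynomial representation. -/
def genAct : KLRGen (Fin N ⊕ Fin N) n → PolySpace 𝕜 N n →ₗ[𝕜] PolySpace 𝕜 N n
  | .e i =>
    { toFun := fun f ν => if Sum.inr ∘ ν = i then f ν else 0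
      map_add' := fun f g => by ext1 ν; by_cases h : Sum.inr ∘ ν = i <;> simp [h]
      map_smul' := fun c f => by ext1 ν; by_cases h : Sum.inr ∘ ν = i <;> simp [h] }
  | .x j =>
    { toFun := fun f ν => X j * f ν
      map_add' := fun f g => by ext1 ν; simp [mul_add]
      map_smul' := fun c f => by ext1 ν; simp }
  | .psi j =>
    { toFun := fun f ν =>
        if ν (lpos j) = ν (rpos j) then divDiff (lpos j) (rpos j) (lpos_ne_rpos j) (f ν)
        else swapVars (lpos j) (rpos j) (f (ν ∘ Equiv.swap (lpos j) (rpos j)))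
      map_add' := fun f g => by
        ext1 ν; by_cases h : ν (lpos j) = ν (rpos j) <;> simp [h]
      map_smul' := fun c f => by
        ext1 ν; by_cases h : ν (lpos j) = ν (rpos j) <;> simp [h] }

/-- The right action of the free algebra on the polynomial representation. -/
def freeAct : FreeAlgebra 𝕜 (KLRGen (Fin N ⊕ Fin N) n) →ₐ[𝕜]
    (Module.End 𝕜 (PolySpace 𝕜 N n))ᵐᵒᵖ :=
  FreeAlgebra.lift 𝕜 fun g => MulOpposite.op (genAct 𝕜 N n g)

variable {𝕜} {N n}

lemma freeAct_mul (a b : FreeAlgebra 𝕜 (KLRGen (Fin N ⊕ Fin N) n)) (f : PolySpace 𝕜 N n) :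
    (freeAct 𝕜 N n (a * b)).unop f = (freeAct 𝕜 N n b).unop ((freeAct 𝕜 N n a).unop f) := by
  simp

lemma freeAct_Ef (i : Fin n → Fin N ⊕ Fin N) (f : PolySpace 𝕜 N n) (ν : Fin n → Fin N) :
    (freeAct 𝕜 N n (Ef 𝕜 _ n i)).unop f ν = if Sum.inr ∘ ν = i then f ν else 0 := by
  simp [freeAct, Ef, genAct]

lemma freeAct_Xf (j : Fin n) (f : PolySpace 𝕜 N n) (ν : Fin n → Fin N) :
    (freeAct 𝕜 N n (Xf 𝕜 _ n j)).unop f ν = X j * f ν := by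
  simp [freeAct, Xf, genAct]

lemma freeAct_Pf (j : Fin (n - 1)) (f : PolySpace 𝕜 N n) (ν : Fin n → Fin N) :
    (freeAct 𝕜 N n (Pf 𝕜 _ n j)).unop f ν =
      if ν (lpos j) = ν (rpos j) then divDiff (lpos j) (rpos j) (lpos_ne_rpos j) (f ν)
      else swapVars (lpos j) (rpos j) (f (ν ∘ Equiv.swap (lpos j) (rpos j))) := by
  simp [freeAct, Pf, genAct]

lemma freeAct_mul_Ef (a : FreeAlgebra 𝕜 (KLRGen (Fin N ⊕ Fin N) n))
    (i : Fin n → Fin N ⊕ Fin N) (f : PolySpace 𝕜 N n) (ν : Fin n → Fin N) :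
    (freeAct 𝕜 N n (a * Ef 𝕜 _ n i)).unop f ν =
      if Sum.inr ∘ ν = i then (freeAct 𝕜 N n a).unop f ν else 0 := by
  rw [freeAct_mul, freeAct_Ef]

lemma comp_swap_comp_swap {α β : Type} [DecidableEq α] (f : α → β) (i j : α) :
    (f ∘ Equiv.swap i j) ∘ Equiv.swap i j = f := by
  ext; simp

lemma freeAct_Pf_Pf {j : Fin (n - 1)} {ν : Fin n → Fin N} (f : PolySpace 𝕜 N n) :
    (freeAct 𝕜 N n (Pf 𝕜 _ n j * Pf 𝕜 _ n j)).unop f ν =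
      if ν (lpos j) = ν (rpos j) then 0 else f ν := by
  rw [freeAct_mul, freeAct_Pf, freeAct_Pf, freeAct_Pf]
  by_cases h : ν (lpos j) = ν (rpos j)
  · simp [h, divDiff_divDiff]
  · simp [h, Ne.symm h, comp_swap_comp_swap]

lemma freeAct_Pf_comm {j k : Fin (n - 1)} (h : (j : ℕ) + 1 < k) (f : PolySpace 𝕜 N n) :
    (freeAct 𝕜 N n (Pf 𝕜 _ n j * Pf 𝕜 _ n k)).unop f =
      (freeAct 𝕜 N n (Pf 𝕜 _ n k * Pf 𝕜 _ n j)).unop f := by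
  ext1 ν
  have h1 : lpos j ≠ lpos k := lpos_ne_lpos (by omega)
  have h2 : rpos j ≠ rpos k := rpos_ne_rpos (by omega)
  have h3 : lpos j ≠ rpos k := lpos_ne_rpos_of (by omega)
  have h4 : rpos j ≠ lpos k := (lpos_ne_rpos_of (by omega)).symm
  have hc : (ν ∘ Equiv.swap (lpos j) (rpos j)) ∘ Equiv.swap (lpos k) (rpos k) =
      (ν ∘ Equiv.swap (lpos k) (rpos k)) ∘ Equiv.swap (lpos j) (rpos j) := by
    ext a
    simp only [Function.comp_apply, Equiv.swap_apply_def]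
    grind
  simp only [freeAct_mul, freeAct_Pf, Function.comp_apply, hc,
    Equiv.swap_apply_of_ne_of_ne h1 h3, Equiv.swap_apply_of_ne_of_ne h4 h2,
    Equiv.swap_apply_of_ne_of_ne h1.symm h4.symm, Equiv.swap_apply_of_ne_of_ne h3.symm h2.symm]
  split_ifs with hj hk hk
  · exact divDiff_comm _ _ h1.symm h4.symm h3.symm h2.symm _
  · exact divDiff_swapVars_comm _ h1.symm h4.symm h3.symm h2.symm _
  · exact (divDiff_swapVars_comm _ h1 h3 h4 h2 _).symm
  · exact swapVars_comm h1.symm h4.symm h3.symm h2.symm _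

lemma divDiff_swapVars_swapVars {σ : Type} [DecidableEq σ] {i j k : σ} (hij : i ≠ j)
    (hik : i ≠ k) (hjk : j ≠ k) (p : MvPolynomial σ 𝕜) :
    divDiff j k hjk (swapVars i j (swapVars j k p)) =
      swapVars i j (swapVars j k (divDiff i j hij p)) := by
  apply divDiff_eq
  have := congrArg (fun q => swapVars i j (swapVars j k q)) (mul_divDiff hij p)
  simp only [map_mul, map_sub, swapVars_X, Equiv.swap_apply_left,
    Equiv.swap_apply_of_ne_of_ne hij hik, Equiv.swap_apply_of_ne_of_ne hik.symm hjk.symm] at this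
  rw [this, swapVars_braid hij hik hjk]

lemma divDiff_swapVars_swapVars' {σ : Type} [DecidableEq σ] {i j k : σ} (hij : i ≠ j)
    (hik : i ≠ k) (hjk : j ≠ k) (p : MvPolynomial σ 𝕜) :
    divDiff i j hij (swapVars j k (swapVars i j p)) =
      swapVars j k (swapVars i j (divDiff j k hjk p)) := by
  apply divDiff_eq
  have := congrArg (fun q => swapVars j k (swapVars i j q)) (mul_divDiff hjk p)
  simp only [map_mul, map_sub, swapVars_X, Equiv.swap_apply_right,
    Equiv.swap_apply_of_ne_of_ne hij hik, Equiv.swap_apply_of_ne_of_ne hik.symm hjk.symm] at this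
  rw [this, swapVars_braid hij hik hjk]

lemma swapVars_divDiff_swapVars {σ : Type} [DecidableEq σ] {i j k : σ} (hij : i ≠ j)
    (hik : i ≠ k) (hjk : j ≠ k) (p : MvPolynomial σ 𝕜) :
    swapVars i j (divDiff j k hjk (swapVars i j p)) =
      swapVars j k (divDiff i j hij (swapVars j k p)) := by
  apply mul_left_cancel₀ (X_sub_X_ne_zero (𝕜 := 𝕜) hik)
  have h1 := congrArg (swapVars i j) (mul_divDiff hjk (swapVars i j p))
  have h2 := congrArg (swapVars j k) (mul_divDiff hij (swapVars j k p))
  simp only [map_mul, map_sub, swapVars_X, Equiv.swap_apply_left, Equiv.swap_apply_right,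
    Equiv.swap_apply_of_ne_of_ne hij hik, Equiv.swap_apply_of_ne_of_ne hik.symm hjk.symm,
    swapVars_swapVars] at h1 h2
  rw [h1, h2, swapVars_braid hij hik hjk]

lemma freeAct_Pf_braid {j k : Fin (n - 1)} (h : (j : ℕ) + 1 = k) (f : PolySpace 𝕜 N n) :
    (freeAct 𝕜 N n (Pf 𝕜 _ n j * Pf 𝕜 _ n k * Pf 𝕜 _ n j)).unop f =
      (freeAct 𝕜 N n (Pf 𝕜 _ n k * Pf 𝕜 _ n j * Pf 𝕜 _ n k)).unop f := by
  ext1 ν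
  have h1 : lpos j ≠ lpos k := lpos_ne_lpos (by omega)
  have h2 : rpos j ≠ rpos k := rpos_ne_rpos (by omega)
  have h3 : lpos j ≠ rpos k := lpos_ne_rpos_of (by omega)
  have h4 : rpos j = lpos k := rpos_eq_lpos h
  have h5 := lpos_ne_rpos k
  have hc : ((ν ∘ Equiv.swap (lpos j) (lpos k)) ∘ Equiv.swap (lpos k) (rpos k)) ∘
      Equiv.swap (lpos j) (lpos k) =
      ((ν ∘ Equiv.swap (lpos k) (rpos k)) ∘ Equiv.swap (lpos j) (lpos k)) ∘
        Equiv.swap (lpos k) (rpos k) := by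
    ext a
    simp only [Function.comp_apply, Equiv.swap_apply_def]
    grind
  simp only [freeAct_mul, freeAct_Pf, Function.comp_apply, h4, hc, Equiv.swap_apply_left,
    Equiv.swap_apply_right, Equiv.swap_apply_of_ne_of_ne h1 h3,
    Equiv.swap_apply_of_ne_of_ne h3.symm h5.symm]
  simp only [eq_comm (a := ν (rpos k)), eq_comm (a := ν (lpos k)) (b := ν (lpos j))]
  by_cases hab : ν (lpos j) = ν (lpos k) <;> by_cases hbc : ν (lpos k) = ν (rpos k) <;>
    by_cases hac : ν (lpos j) = ν (rpos k)
  all_goals try (exfalso; grind)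
  all_goals simp only [hab, hbc, hac, if_true, if_false]
  · exact divDiff_braid h1 h3 h5 _
  · exact divDiff_swapVars_swapVars' h1 h3 h5 _
  · exact (divDiff_swapVars_swapVars h1 h3 h5 _).symm
  · rw [if_neg (Ne.symm hbc), if_neg (Ne.symm hbc), comp_swap_comp_swap, comp_swap_comp_swap]
    exact swapVars_divDiff_swapVars h1 h3 h5 _
  · exact swapVars_braid h1 h3 h5 _

lemma swapVars_eq_sub {σ : Type} [DecidableEq σ] {i j : σ} (h : i ≠ j) (p : MvPolynomial σ 𝕜) :
    swapVars i j p = p - (X i - X j) * divDiff i j h p := by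
  rw [mul_divDiff, sub_sub_cancel]

lemma freeAct_sum {ι : Type} (s : Finset ι)
    (a : ι → FreeAlgebra 𝕜 (KLRGen (Fin N ⊕ Fin N) n)) (f : PolySpace 𝕜 N n) :
    (freeAct 𝕜 N n (∑ l ∈ s, a l)).unop f = ∑ l ∈ s, (freeAct 𝕜 N n (a l)).unop f := by
  simp [map_sum, Finset.unop_sum, LinearMap.sum_apply]

lemma freeAct_eq_of_rel {C : CartanDatum (Fin N)} {t : Fin N ⊕ Fin N → Fin N ⊕ Fin N → 𝕜}
    (ht : ∀ a b, extForm C a b = 0 → t a b = 1)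
    ⦃a b : FreeAlgebra 𝕜 (KLRGen (Fin N ⊕ Fin N) n)⦄
    (h : KLRRel 𝕜 (Fin N ⊕ Fin N) n (extForm C) t (fun _ => 1) (fun _ _ _ _ => 0) a b) :
    freeAct 𝕜 N n a = freeAct 𝕜 N n b := by
  apply MulOpposite.unop_injective
  apply LinearMap.ext
  intro f
  cases h with
  | ee i j =>
    ext1 ν
    rw [freeAct_mul_Ef, freeAct_Ef]
    by_cases hij : i = j
    · subst hij
      rw [if_pos rfl, freeAct_Ef]
      split_ifs <;> rfl
    · rw [if_neg hij]
      split_ifs with h1 h2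
      · exact absurd (h2.symm.trans h1) hij
      · simp
      · simp
  | esum =>
    ext1 ν
    simp only [freeAct_sum, Finset.sum_apply, freeAct_Ef]
    simp
  | xe j i =>
    ext1 ν
    rw [freeAct_mul_Ef, freeAct_mul, freeAct_Xf, freeAct_Xf, freeAct_Ef]
    split_ifs <;> simp
  | psie j i =>
    ext1 ν
    rw [freeAct_mul_Ef, freeAct_mul, freeAct_Pf, freeAct_Pf, freeAct_Ef, freeAct_Ef]
    have hi : Sum.inr ∘ (ν ∘ Equiv.swap (lpos j) (rpos j)) =
        i ∘ Equiv.swap (lpos j) (rpos j) ↔ Sum.inr ∘ ν = i := by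
      rw [← Function.comp_assoc]
      exact (Equiv.swap (lpos j) (rpos j)).surjective.injective_comp_right.eq_iff
    by_cases hν : ν (lpos j) = ν (rpos j)
    · rw [if_pos hν, if_pos hν]
      have hs : ν ∘ Equiv.swap (lpos j) (rpos j) = ν := by
        ext1 a
        simp only [Function.comp_apply, Equiv.swap_apply_def]
        grind
      rw [hs] at hi
      simp only [hi]
      split_ifs <;> simp
    · rw [if_neg hν, if_neg hν]
      simp only [hi]
      split_ifs <;> simp
  | xx j k =>
    ext1 ν
    simp only [freeAct_mul, freeAct_Xf]
    ring
  | psix j k h1 h2 =>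
    ext1 ν
    simp only [freeAct_mul, freeAct_Xf, freeAct_Pf]
    split_ifs
    · rw [divDiff_mul, divDiff_X_of_ne _ h1 h2, zero_mul, zero_add]
    · simp [Equiv.swap_apply_of_ne_of_ne h1 h2]
  | psipsi j k h => exact freeAct_Pf_comm h f
  | dot1 j i =>
    ext1 ν
    simp only [map_sub, MulOpposite.unop_sub, LinearMap.sub_apply, Pi.sub_apply, freeAct_mul_Ef]
    by_cases hν : Sum.inr ∘ ν = i
    · subst hν
      simp only [if_true, Function.comp_apply, Sum.inr.injEq, one_smul, freeAct_mul, freeAct_Xf,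
        freeAct_Pf]
      split_ifs with hj
      · rw [divDiff_mul, divDiff_X_left, swapVars_eq_sub (lpos_ne_rpos j), freeAct_Ef, if_pos rfl]
        ring
      · simp
    · simp only [if_neg hν]
      split_ifs <;> simp [freeAct_Ef, hν]
  | dot2 j i =>
    ext1 ν
    simp only [map_sub, MulOpposite.unop_sub, LinearMap.sub_apply, Pi.sub_apply, freeAct_mul_Ef]
    by_cases hν : Sum.inr ∘ ν = i
    · subst hν
      simp only [if_true, Function.comp_apply, Sum.inr.injEq, one_smul, freeAct_mul, freeAct_Xf,
        freeAct_Pf]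
      split_ifs with hj
      · rw [divDiff_mul, divDiff_X_right, swapVars_eq_sub (lpos_ne_rpos j), freeAct_Ef, if_pos rfl]
        ring
      · simp
    · simp only [if_neg hν]
      split_ifs <;> simp [freeAct_Ef, hν]
  | psisq j i =>
    ext1 ν
    rw [freeAct_mul_Ef]
    by_cases hν : Sum.inr ∘ ν = i
    · subst hν
      simp only [if_true, Function.comp_apply, Sum.inr.injEq, freeAct_Pf_Pf]
      split_ifs with hj hB
      · simp
      · simp [ht _ _ hB, freeAct_Ef]
      · exact absurd (extForm_inr_of_ne C hj) hB
    · rw [if_neg hν]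
      split_ifs with hj hB
      · simp
      · simp [freeAct_Ef, hν]
      · rw [freeAct_mul_Ef, if_neg hν]
  | braid j k h i =>
    ext1 ν
    simp only [map_sub, MulOpposite.unop_sub, LinearMap.sub_apply, Pi.sub_apply, freeAct_mul_Ef]
    by_cases hν : Sum.inr ∘ ν = i
    · subst hν
      rw [if_pos rfl, if_pos rfl, freeAct_Pf_braid h, sub_self,
        if_neg fun hc => not_cB_extForm_inr_add_one_nonpos C _ _ hc.2]
      simp
    · rw [if_neg hν, if_neg hν, sub_self]
      split_ifs
      · simp [Finset.sum_apply, freeAct_Ef, hν]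
      · simp

end PolynomialRepresentation

section Transport

variable {N n : ℕ} {A : Type} [Ring A]

/-- The KLR relations among the idempotents, dots and crossings of dashed strands. -/
structure DashedRelations (E : (Fin n → Fin N) → A) (X : Fin n → A) (P : Fin (n - 1) → A) :
    Prop where
  E_mul_E : ∀ ν, E ν * E ν = E ν
  X_mul_E : ∀ j ν, X j * E ν = E ν * X j
  P_mul_E : ∀ j ν, P j * E ν = E (ν ∘ Equiv.swap (lpos j) (rpos j)) * P j
  X_mul_X : ∀ j k, X j * X k = X k * X j
  P_mul_X : ∀ j k, k ≠ lpos j → k ≠ rpos j → P j * X k = X k * P j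
  P_mul_P : ∀ j k : Fin (n - 1), (j : ℕ) + 1 < k → P j * P k = P k * P j
  X_mul_P : ∀ j ν, X (lpos j) * P j * E ν =
    P j * X (rpos j) * E ν + if ν (lpos j) = ν (rpos j) then E ν else 0
  X_mul_P' : ∀ j ν, X (rpos j) * P j * E ν =
    P j * X (lpos j) * E ν - if ν (lpos j) = ν (rpos j) then E ν else 0
  P_sq : ∀ j ν, P j * P j * E ν = if ν (lpos j) = ν (rpos j) then 0 else E ν
  braid : ∀ j k : Fin (n - 1), (j : ℕ) + 1 = k → ∀ ν,
    P j * P k * P j * E ν = P k * P j * P k * E ν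

/-- The crossing of a bubble sort of the colour sequence `ν`, applied to the element `a` at the
sorted sequence `μ`; it vanishes if `ν` is not a rearrangement of `μ`. -/
def transport (P : Fin (n - 1) → A) (μ : Fin n → Fin N) (a : A) (ν : Fin n → Fin N) : A :=
  if h : ∃ j, ν (rpos j) < ν (lpos j) then
    transport P μ a (ν ∘ Equiv.swap (lpos h.choose) (rpos h.choose)) * P h.choose
  else if ν = μ then a else 0
termination_by (wellFounded_lt (α := Lex (Fin n → Fin N))).wrap (toLex ν)
decreasing_by exact Pi.lex_desc (lpos_lt_rpos _).le h.choose_spec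

variable {E : (Fin n → Fin N) → A} {X : Fin n → A} {P : Fin (n - 1) → A}
  {μ : Fin n → Fin N} {a : A}

lemma transport_of_sorted {ν : Fin n → Fin N} (h : ∀ j, ν (lpos j) ≤ ν (rpos j)) :
    transport P μ a ν = if ν = μ then a else 0 := by
  rw [transport, dif_neg]
  simpa using h

lemma exists_transport_eq {ν : Fin n → Fin N} {j : Fin (n - 1)} (h : ν (rpos j) < ν (lpos j)) :
    ∃ k, ν (rpos k) < ν (lpos k) ∧
      transport P μ a ν = transport P μ a (ν ∘ Equiv.swap (lpos k) (rpos k)) * P k := by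
  have h' : ∃ j, ν (rpos j) < ν (lpos j) := ⟨j, h⟩
  refine ⟨h'.choose, h'.choose_spec, ?_⟩
  rw [transport, dif_pos h']

lemma comp_swap_lt {ν : Fin n → Fin N} {j : Fin (n - 1)} (h : ν (rpos j) < ν (lpos j)) :
    toLex (ν ∘ Equiv.swap (lpos j) (rpos j)) < toLex ν :=
  Pi.lex_desc (lpos_lt_rpos _).le h

lemma exists_descent_or_sorted (ν : Fin n → Fin N) :
    (∃ j, ν (rpos j) < ν (lpos j)) ∨ ∀ j, ν (lpos j) ≤ ν (rpos j) := by
  by_cases h : ∃ j, ν (rpos j) < ν (lpos j)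
  · exact Or.inl h
  · exact Or.inr (by simpa using h)

lemma comp_swap_eq {ν : Fin n → Fin N} {j : Fin (n - 1)} (h : ν (lpos j) = ν (rpos j)) :
    ν ∘ Equiv.swap (lpos j) (rpos j) = ν := by
  ext1 b
  simp only [Function.comp_apply, Equiv.swap_apply_def]
  grind

lemma comp_swap_braid {j k : Fin (n - 1)} (h : (j : ℕ) + 1 = k ∨ (k : ℕ) + 1 = j)
    (ν : Fin n → Fin N) :
    ((ν ∘ Equiv.swap (lpos j) (rpos j)) ∘ Equiv.swap (lpos k) (rpos k)) ∘
      Equiv.swap (lpos j) (rpos j) =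
    ((ν ∘ Equiv.swap (lpos k) (rpos k)) ∘ Equiv.swap (lpos j) (rpos j)) ∘
      Equiv.swap (lpos k) (rpos k) := by
  wlog hjk : (j : ℕ) + 1 = k generalizing j k
  · exact (this h.symm (h.resolve_left hjk)).symm
  have h1 : lpos j ≠ lpos k := lpos_ne_lpos (by omega)
  have h3 : lpos j ≠ rpos k := lpos_ne_rpos_of (by omega)
  have h5 := lpos_ne_rpos k
  ext1 x
  simp only [Function.comp_apply, Equiv.swap_apply_def, rpos_eq_lpos hjk]
  grind

lemma comp_swap_comm {j k : Fin (n - 1)} (h : (j : ℕ) + 1 < k ∨ (k : ℕ) + 1 < j)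
    (ν : Fin n → Fin N) :
    (ν ∘ Equiv.swap (lpos j) (rpos j)) ∘ Equiv.swap (lpos k) (rpos k) =
      (ν ∘ Equiv.swap (lpos k) (rpos k)) ∘ Equiv.swap (lpos j) (rpos j) := by
  have h1 : lpos j ≠ lpos k := lpos_ne_lpos (by omega)
  have h2 : rpos j ≠ rpos k := rpos_ne_rpos (by omega)
  have h3 : lpos j ≠ rpos k := lpos_ne_rpos_of (by omega)
  have h4 : rpos j ≠ lpos k := (lpos_ne_rpos_of (by omega)).symm
  ext1 x
  simp only [Function.comp_apply, Equiv.swap_apply_def]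
  grind

/-- The values of `ν ∘ swap` at the two strands of a crossing far from the swapped strands. -/
lemma comp_swap_apply_far {j k : Fin (n - 1)} (h : (j : ℕ) + 1 < k ∨ (k : ℕ) + 1 < j)
    (ν : Fin n → Fin N) :
    (ν ∘ Equiv.swap (lpos k) (rpos k)) (lpos j) = ν (lpos j) ∧
      (ν ∘ Equiv.swap (lpos k) (rpos k)) (rpos j) = ν (rpos j) := by
  have h1 : lpos j ≠ lpos k := lpos_ne_lpos (by omega)
  have h2 : rpos j ≠ rpos k := rpos_ne_rpos (by omega)
  have h3 : lpos j ≠ rpos k := lpos_ne_rpos_of (by omega)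
  have h4 : rpos j ≠ lpos k := (lpos_ne_rpos_of (by omega)).symm
  simp [Equiv.swap_apply_of_ne_of_ne h1 h3, Equiv.swap_apply_of_ne_of_ne h4 h2]

/-- The colours after two crossings of three consecutive strands, at the first of the two
crossings. -/
lemma comp_swap_comp_swap_apply_adjacent {j k : Fin (n - 1)}
    (h : (j : ℕ) + 1 = k ∨ (k : ℕ) + 1 = j) (ν : Fin n → Fin N) :
    ((ν ∘ Equiv.swap (lpos k) (rpos k)) ∘ Equiv.swap (lpos j) (rpos j)) (lpos k) = ν (lpos j) ∧
    ((ν ∘ Equiv.swap (lpos k) (rpos k)) ∘ Equiv.swap (lpos j) (rpos j)) (rpos k) =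
      ν (rpos j) := by
  have h1 := lpos_ne_rpos j
  have h2 := lpos_ne_rpos k
  simp only [Function.comp_apply, Equiv.swap_apply_def]
  rcases h with h | h
  · have h0 := rpos_eq_lpos h
    have h3 : lpos j ≠ rpos k := lpos_ne_rpos_of (by omega)
    grind
  · have h0 := rpos_eq_lpos h
    have h3 : lpos k ≠ rpos j := lpos_ne_rpos_of (by omega)
    grind

lemma descent_comp_swap_adjacent {j k : Fin (n - 1)}
    (h : (j : ℕ) + 1 = k ∨ (k : ℕ) + 1 = j) {ν : Fin n → Fin N}
    (hj : ν (rpos j) ≤ ν (lpos j)) (hk : ν (rpos k) < ν (lpos k)) :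
    (ν ∘ Equiv.swap (lpos k) (rpos k)) (rpos j) < (ν ∘ Equiv.swap (lpos k) (rpos k)) (lpos j) := by
  have h1 := lpos_ne_rpos j
  have h2 := lpos_ne_rpos k
  simp only [Function.comp_apply, Equiv.swap_apply_def]
  rcases h with h | h
  · have h0 := rpos_eq_lpos h
    have h3 : lpos j ≠ rpos k := lpos_ne_rpos_of (by omega)
    grind
  · have h0 := rpos_eq_lpos h
    have h3 : lpos k ≠ rpos j := lpos_ne_rpos_of (by omega)
    grind

namespace DashedRelations

variable (hR : DashedRelations E X P)

include hR

lemma P_comm {j k : Fin (n - 1)} (h : (j : ℕ) + 1 < k ∨ (k : ℕ) + 1 < j) :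
    P j * P k = P k * P j :=
  h.elim (hR.P_mul_P j k) fun h => (hR.P_mul_P k j h).symm

lemma braid' {j k : Fin (n - 1)} (h : (j : ℕ) + 1 = k ∨ (k : ℕ) + 1 = j) (ν : Fin n → Fin N) :
    P j * P k * P j * E ν = P k * P j * P k * E ν :=
  h.elim (fun h => hR.braid j k h ν) fun h => (hR.braid k j h ν).symm

lemma E_mul_P (j : Fin (n - 1)) (ν : Fin n → Fin N) :
    E ν * P j = P j * E (ν ∘ Equiv.swap (lpos j) (rpos j)) := by
  rw [hR.P_mul_E, comp_swap_comp_swap]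

variable (ha : a * E μ = a)
include ha

lemma transport_mul_E (ν : Fin n → Fin N) : transport P μ a ν * E ν = transport P μ a ν := by
  induction hl : toLex ν using WellFoundedLT.induction generalizing ν with
  | ind x ih =>
  subst hl
  rcases exists_descent_or_sorted ν with ⟨j, hj⟩ | hs
  · obtain ⟨k, hk, e⟩ := exists_transport_eq (P := P) (μ := μ) (a := a) hj
    rw [e, mul_assoc, hR.P_mul_E, ← mul_assoc, ih _ (comp_swap_lt hk) _ rfl]
  · rw [transport_of_sorted hs]
    split_ifs with h
    · rw [h, ha]
    · rw [zero_mul]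

lemma transport_mul_braid {j k : Fin (n - 1)} (h : (j : ℕ) + 1 = k ∨ (k : ℕ) + 1 = j)
    (ν : Fin n → Fin N) :
    transport P μ a ν * P j * P k * P j = transport P μ a ν * P k * P j * P k := by
  have key : ∀ b c d : Fin (n - 1), transport P μ a ν * P b * P c * P d =
      transport P μ a ν * (P b * P c * P d * E (((ν ∘ Equiv.swap (lpos b) (rpos b)) ∘
        Equiv.swap (lpos c) (rpos c)) ∘ Equiv.swap (lpos d) (rpos d))) := by
    intro b c d
    conv_lhs => rw [← hR.transport_mul_E ha]
    simp only [mul_assoc, hR.E_mul_P]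
  rw [key, key, hR.braid' h]
  rw [comp_swap_braid h]

variable (ha' : ∀ j, μ (lpos j) = μ (rpos j) → a * P j = 0)
include ha'

lemma transport_mul_P_aux (ν : Fin n → Fin N) :
    (∀ j, ν (lpos j) = ν (rpos j) → transport P μ a ν * P j = 0) ∧
    (∀ j, ν (rpos j) < ν (lpos j) → transport P μ a ν =
      transport P μ a (ν ∘ Equiv.swap (lpos j) (rpos j)) * P j) := by
  induction hl : toLex ν using WellFoundedLT.induction generalizing ν with
  | ind x ih =>
  subst hl
  replace ih : ∀ ν', toLex ν' < toLex ν →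
    (∀ j, ν' (lpos j) = ν' (rpos j) → transport P μ a ν' * P j = 0) ∧
    (∀ j, ν' (rpos j) < ν' (lpos j) → transport P μ a ν' =
      transport P μ a (ν' ∘ Equiv.swap (lpos j) (rpos j)) * P j) := fun ν' h => ih _ h ν' rfl
  rcases exists_descent_or_sorted ν with ⟨j, hj⟩ | hs
  swap
  · rw [transport_of_sorted hs]
    refine ⟨fun j hj => ?_, fun j hj => absurd hj (hs j).not_gt⟩
    split_ifs with h
    · exact ha' j (h ▸ hj)
    · rw [zero_mul]
  obtain ⟨k, hk, e⟩ := exists_transport_eq (P := P) (μ := μ) (a := a) hj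
  have hlt := comp_swap_lt hk
  have trichotomy : ∀ j : Fin (n - 1), j = k ∨ ((j : ℕ) + 1 < k ∨ (k : ℕ) + 1 < j) ∨
      ((j : ℕ) + 1 = k ∨ (k : ℕ) + 1 = j) := by
    intro j
    rw [Fin.ext_iff]
    omega
  clear j hj
  refine ⟨fun j hj => ?_, fun j hj => ?_⟩
  · rcases trichotomy j with h | h | h
    · subst h
      exact absurd hj hk.ne'
    · obtain ⟨hl, hr⟩ := comp_swap_apply_far h ν
      rw [e, mul_assoc, ← hR.P_comm h, ← mul_assoc, (ih _ hlt).1 j (by rw [hl, hr, hj]), zero_mul]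
    · have hd := descent_comp_swap_adjacent h hj.ge hk
      obtain ⟨hl, hr⟩ := comp_swap_comp_swap_apply_adjacent h ν
      rw [e, (ih _ hlt).2 j hd, hR.transport_mul_braid ha h,
        (ih _ ((comp_swap_lt hd).trans hlt)).1 k (by rw [hl, hr, hj]), zero_mul, zero_mul]
  · have hlt' := comp_swap_lt hj
    rcases trichotomy j with h | h | h
    · rw [h, e]
    · obtain ⟨hl, hr⟩ := comp_swap_apply_far h ν
      obtain ⟨hl', hr'⟩ := comp_swap_apply_far h.symm ν
      rw [e, (ih _ hlt).2 j (by rw [hl, hr]; exact hj),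
        (ih _ hlt').2 k (by rw [hl', hr']; exact hk), mul_assoc, mul_assoc, hR.P_comm h,
        comp_swap_comm h]
    · have hd := descent_comp_swap_adjacent h hj.le hk
      have hd' := descent_comp_swap_adjacent h.symm hk.le hj
      obtain ⟨hl, hr⟩ := comp_swap_comp_swap_apply_adjacent h ν
      obtain ⟨hl', hr'⟩ := comp_swap_comp_swap_apply_adjacent h.symm ν
      rw [e, (ih _ hlt).2 j hd, (ih _ ((comp_swap_lt hd).trans hlt)).2 k (by rw [hl, hr]; exact hj),
        (ih _ hlt').2 k hd',
        (ih _ ((comp_swap_lt hd').trans hlt')).2 j (by rw [hl', hr']; exact hk),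
        hR.transport_mul_braid ha h.symm, comp_swap_braid h]

lemma transport_mul_P_of_eq {ν : Fin n → Fin N} {j : Fin (n - 1)}
    (h : ν (lpos j) = ν (rpos j)) : transport P μ a ν * P j = 0 :=
  (hR.transport_mul_P_aux ha ha' ν).1 j h

lemma transport_mul_P_of_ne {ν : Fin n → Fin N} {j : Fin (n - 1)}
    (h : ν (lpos j) ≠ ν (rpos j)) :
    transport P μ a ν * P j = transport P μ a (ν ∘ Equiv.swap (lpos j) (rpos j)) := by
  rcases h.lt_or_gt with h | h
  · rw [(hR.transport_mul_P_aux ha ha' (ν ∘ Equiv.swap (lpos j) (rpos j))).2 j (by simpa using h),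
      comp_swap_comp_swap]
  · rw [(hR.transport_mul_P_aux ha ha' ν).2 j h]
    generalize hν' : ν ∘ Equiv.swap (lpos j) (rpos j) = ν'
    have hne : ν' (lpos j) ≠ ν' (rpos j) := by simpa [← hν'] using h.ne
    have hE : E ν' * (P j * P j) = P j * P j * E ν' := by
      rw [← mul_assoc, hR.E_mul_P, mul_assoc, hR.E_mul_P, comp_swap_comp_swap, mul_assoc]
    rw [← hR.transport_mul_E ha, mul_assoc, mul_assoc, hE, hR.P_sq, if_neg hne]

end DashedRelations
end Transport

section DotEvaluation

open MvPolynomial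

variable {𝕜 : Type} [Field 𝕜] {N n : ℕ} {A : Type} [Ring A] [Algebra 𝕜 A]

open scoped IsMulCommutative in
/-- Evaluation of a polynomial at pairwise commuting elements of an algebra. -/
def commEval {σ : Type} (X : σ → A) (h : ∀ j k, X j * X k = X k * X j) :
    MvPolynomial σ 𝕜 →ₐ[𝕜] A :=
  haveI := Algebra.isMulCommutative_adjoin 𝕜 (s := Set.range X) (by
    rintro _ ⟨j, rfl⟩ _ ⟨k, rfl⟩
    exact h j k)
  (Algebra.adjoin 𝕜 (Set.range X)).val.comp
    (aeval fun j => (⟨X j, Algebra.subset_adjoin ⟨j, rfl⟩⟩ : Algebra.adjoin 𝕜 (Set.range X)))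

@[simp]
lemma commEval_X {σ : Type} {X : σ → A} (h : ∀ j k, X j * X k = X k * X j) (j : σ) :
    commEval X h (MvPolynomial.X j : MvPolynomial σ 𝕜) = X j := by
  simp [commEval]

lemma commute_commEval {σ : Type} {X : σ → A} (h : ∀ j k, X j * X k = X k * X j) {b : A}
    (hb : ∀ j, Commute b (X j)) (p : MvPolynomial σ 𝕜) : Commute b (commEval X h p) := by
  induction p using MvPolynomial.induction_on with
  | C c => rw [← algebraMap_eq, AlgHom.commutes]; exact (Algebra.commutes c b).symm
  | add p q hp hq => rw [map_add]; exact hp.add_right hq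
  | mul_X p j hp => rw [map_mul, commEval_X]; exact hp.mul_right (hb j)

namespace DashedRelations

variable {E : (Fin n → Fin N) → A} {X : Fin n → A} {P : Fin (n - 1) → A}
  {μ : Fin n → Fin N} {a : A} (hR : DashedRelations E X P)

include hR

lemma commEval_mul_E (ν : Fin n → Fin N) (p : MvPolynomial (Fin n) 𝕜) :
    commEval X hR.X_mul_X p * E ν = E ν * commEval X hR.X_mul_X p :=
  (commute_commEval hR.X_mul_X (fun j => (hR.X_mul_E j ν).symm) p).eq.symm

lemma commEval_mul_P (j : Fin (n - 1)) (ν : Fin n → Fin N) (p : MvPolynomial (Fin n) 𝕜) :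
    commEval X hR.X_mul_X p * P j * E ν =
      P j * commEval X hR.X_mul_X (swapVars (lpos j) (rpos j) p) * E ν +
      if ν (lpos j) = ν (rpos j) then
        commEval X hR.X_mul_X (divDiff (lpos j) (rpos j) (lpos_ne_rpos j) p) * E ν else 0 := by
  have key : ∀ k, X k * P j * E ν = P j * X (Equiv.swap (lpos j) (rpos j) k) * E ν +
      if ν (lpos j) = ν (rpos j) then commEval X hR.X_mul_X
        (divDiff (lpos j) (rpos j) (lpos_ne_rpos j) (MvPolynomial.X k : MvPolynomial (Fin n) 𝕜))
          * E ν else 0 := by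
    intro k
    by_cases hl : k = lpos j
    · subst hl
      rw [Equiv.swap_apply_left, divDiff_X_left, map_one, one_mul, hR.X_mul_P]
    by_cases hr : k = rpos j
    · subst hr
      rw [Equiv.swap_apply_right, divDiff_X_right, map_neg, map_one, neg_one_mul, hR.X_mul_P']
      split_ifs <;> simp [sub_eq_add_neg]
    · rw [Equiv.swap_apply_of_ne_of_ne hl hr, divDiff_X_of_ne _ hl hr, map_zero, zero_mul,
        ite_self, add_zero, hR.P_mul_X j k hl hr]
  induction p using MvPolynomial.induction_on with
  | C c =>
    rw [divDiff_C, map_zero, zero_mul, ite_self, add_zero, ← algebraMap_eq, AlgHom.commutes,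
      AlgHom.commutes, AlgHom.commutes, Algebra.commutes]
  | add p q hp hq =>
    simp only [map_add, add_mul, mul_add, hp, hq]
    split_ifs
    · abel
    · abel
  | mul_X p k hp =>
    rw [divDiff_mul, map_mul, map_mul, map_add, map_mul, map_mul, swapVars_X, commEval_X,
      commEval_X, mul_assoc, mul_assoc, ← mul_assoc (X k), key, mul_add, ← mul_assoc, ← mul_assoc,
      mul_assoc _ (X _) (E ν), hR.X_mul_E, ← mul_assoc, hp]
    simp only [add_mul, mul_assoc, ← hR.X_mul_E]
    split_ifs
    · simp [mul_assoc, ← hR.X_mul_E, add_assoc]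
    · simp

/-- The map from the polynomial representation to the algebra sending a polynomial at `ν` to
its product with the transport of `a` to `ν`. -/
def polyMap (μ : Fin n → Fin N) (a : A) (f : PolySpace 𝕜 N n) : A :=
  ∑ ν, transport P μ a ν * commEval X hR.X_mul_X (f ν)

lemma polyMap_mul_X (j : Fin n) (f : PolySpace 𝕜 N n) :
    hR.polyMap μ a f * X j = hR.polyMap μ a (genAct 𝕜 N n (.x j) f) := by
  rw [polyMap, polyMap, Finset.sum_mul]
  refine Finset.sum_congr rfl fun ν _ => ?_
  rw [mul_assoc]
  simp only [genAct, LinearMap.coe_mk, AddHom.coe_mk]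
  rw [mul_comm (MvPolynomial.X j), map_mul, commEval_X]

variable (ha : a * E μ = a)
include ha

lemma transport_mul_commEval_mul_E (ν : Fin n → Fin N) (p : MvPolynomial (Fin n) 𝕜) :
    transport P μ a ν * commEval X hR.X_mul_X p * E ν =
      transport P μ a ν * commEval X hR.X_mul_X p := by
  rw [mul_assoc, hR.commEval_mul_E, ← mul_assoc, hR.transport_mul_E ha]

variable (ha' : ∀ j, μ (lpos j) = μ (rpos j) → a * P j = 0)
include ha'

lemma polyMap_mul_P (j : Fin (n - 1)) (f : PolySpace 𝕜 N n) :
    hR.polyMap μ a f * P j = hR.polyMap μ a (genAct 𝕜 N n (.psi j) f) := by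
  rw [polyMap, polyMap, Finset.sum_mul]
  have hinv : Function.Involutive fun ν : Fin n → Fin N => ν ∘ Equiv.swap (lpos j) (rpos j) :=
    fun ν => comp_swap_comp_swap _ _ _
  rw [← Equiv.sum_comp hinv.toPerm fun ν => transport P μ a ν * commEval X hR.X_mul_X
    (genAct 𝕜 N n (.psi j) f ν)]
  refine Finset.sum_congr rfl fun ν _ => ?_
  simp only [Function.Involutive.coe_toPerm, genAct, LinearMap.coe_mk, AddHom.coe_mk,
    Function.comp_apply, Equiv.swap_apply_left, Equiv.swap_apply_right]
  rw [← hR.transport_mul_commEval_mul_E ha, mul_assoc, hR.E_mul_P, mul_assoc, ← mul_assoc _ (P j),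
    hR.commEval_mul_P]
  by_cases h : ν (lpos j) = ν (rpos j)
  · rw [comp_swap_eq h, if_pos h, if_pos h.symm, mul_add, ← mul_assoc, ← mul_assoc,
      hR.transport_mul_P_of_eq ha ha' h, zero_mul, zero_mul, zero_add, ← mul_assoc,
      hR.transport_mul_commEval_mul_E ha]
  · rw [if_neg (by simpa using Ne.symm h), if_neg (Ne.symm h), add_zero, ← mul_assoc, ← mul_assoc,
      hR.transport_mul_P_of_ne ha ha' h, hR.transport_mul_commEval_mul_E ha, comp_swap_comp_swap]

end DashedRelations

end DotEvaluation

section ExtendedKLR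

variable {𝕜 : Type} [Field 𝕜] {N : ℕ} {C : CartanDatum (Fin N)}
  {t : Fin N ⊕ Fin N → Fin N ⊕ Fin N → 𝕜} {n : ℕ}

lemma klrMk_eq_of_rel {J : Type} [Fintype J] {B : J → J → ℤ} {t : J → J → 𝕜} {r : J → 𝕜}
    {s : J → J → ℕ → ℕ → 𝕜} {a b : FreeAlgebra 𝕜 (KLRGen J n)}
    (h : KLRRel 𝕜 J n B t r s a b) : klrMk 𝕜 J n B t r s a = klrMk 𝕜 J n B t r s b :=
  RingQuot.mkAlgHom_rel 𝕜 h

variable (𝕜 C t n) in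
/-- The dot `x_j` of the extended KLR algebra. -/
def dotGen (j : Fin n) : ExtKLR 𝕜 N C t n :=
  xQ 𝕜 (Fin N ⊕ Fin N) n (extForm C) t (fun _ => 1) (fun _ _ _ _ => 0) j

variable (𝕜 C t n) in
/-- The crossing `ψ_j` of the extended KLR algebra. -/
def crossGen (j : Fin (n - 1)) : ExtKLR 𝕜 N C t n :=
  pQ 𝕜 (Fin N ⊕ Fin N) n (extForm C) t (fun _ => 1) (fun _ _ _ _ => 0) j

lemma dashedRelations (ht : ∀ a b, extForm C a b = 0 → t a b = 1) :
    DashedRelations (fun ν => eS 𝕜 N C t n (Sum.inr ∘ ν)) (dotGen 𝕜 C t n)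
      (crossGen 𝕜 C t n) where
  E_mul_E ν := by
    have := klrMk_eq_of_rel (KLRRel.ee (𝕜 := 𝕜) (B := extForm C) (t := t) (r := fun _ => 1)
      (s := fun _ _ _ _ => 0) (Sum.inr ∘ ν) (Sum.inr ∘ ν))
    rwa [if_pos rfl, map_mul] at this
  X_mul_E j ν := by
    have := klrMk_eq_of_rel (KLRRel.xe (𝕜 := 𝕜) (B := extForm C) (t := t) (r := fun _ => 1)
      (s := fun _ _ _ _ => 0) j (Sum.inr ∘ ν))
    rwa [map_mul, map_mul] at this
  P_mul_E j ν := by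
    have := klrMk_eq_of_rel (KLRRel.psie (𝕜 := 𝕜) (B := extForm C) (t := t) (r := fun _ => 1)
      (s := fun _ _ _ _ => 0) j (Sum.inr ∘ ν))
    rwa [map_mul, map_mul] at this
  X_mul_X j k := by
    have := klrMk_eq_of_rel (KLRRel.xx (𝕜 := 𝕜) (B := extForm C) (t := t) (r := fun _ => 1)
      (s := fun _ _ _ _ => 0) j k)
    rwa [map_mul, map_mul] at this
  P_mul_X j k h1 h2 := by
    have := klrMk_eq_of_rel (KLRRel.psix (𝕜 := 𝕜) (B := extForm C) (t := t) (r := fun _ => 1)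
      (s := fun _ _ _ _ => 0) j k h1 h2)
    rwa [map_mul, map_mul] at this
  P_mul_P j k h := by
    have := klrMk_eq_of_rel (KLRRel.psipsi (𝕜 := 𝕜) (B := extForm C) (t := t) (r := fun _ => 1)
      (s := fun _ _ _ _ => 0) j k h)
    rwa [map_mul, map_mul] at this
  X_mul_P j ν := by
    have := klrMk_eq_of_rel (KLRRel.dot1 (𝕜 := 𝕜) (B := extForm C) (t := t) (r := fun _ => 1)
      (s := fun _ _ _ _ => 0) j (Sum.inr ∘ ν))
    simp only [map_sub, map_mul, one_smul, Function.comp_apply, Sum.inr.injEq,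
      apply_ite (klrMk _ _ _ _ _ _ _), map_zero] at this
    exact sub_eq_iff_eq_add'.mp this
  X_mul_P' j ν := by
    have := klrMk_eq_of_rel (KLRRel.dot2 (𝕜 := 𝕜) (B := extForm C) (t := t) (r := fun _ => 1)
      (s := fun _ _ _ _ => 0) j (Sum.inr ∘ ν))
    simp only [map_sub, map_mul, one_smul, Function.comp_apply, Sum.inr.injEq,
      apply_ite (klrMk _ _ _ _ _ _ _), map_zero] at this
    exact eq_sub_of_add_eq' (sub_eq_iff_eq_add.mp this).symm
  P_sq j ν := by
    have := klrMk_eq_of_rel (KLRRel.psisq (𝕜 := 𝕜) (B := extForm C) (t := t) (r := fun _ => 1)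
      (s := fun _ _ _ _ => 0) j (Sum.inr ∘ ν))
    simp only [map_mul, Function.comp_apply, Sum.inr.injEq] at this
    refine Eq.trans this ?_
    split_ifs with h1 h2
    · exact map_zero _
    · rw [ht _ _ h2, one_smul]; rfl
    · exact absurd (extForm_inr_of_ne C h1) h2
  braid j k h ν := by
    have := klrMk_eq_of_rel (KLRRel.braid (𝕜 := 𝕜) (B := extForm C) (t := t) (r := fun _ => 1)
      (s := fun _ _ _ _ => 0) j k h (Sum.inr ∘ ν))
    rw [if_neg fun hc => not_cB_extForm_inr_add_one_nonpos C _ _ hc.2] at this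
    simp only [map_sub, map_mul, map_zero] at this
    exact sub_eq_zero.mp this

/-- The right action of the extended KLR algebra on the polynomial representation. -/
def klrAct (ht : ∀ a b, extForm C a b = 0 → t a b = 1) :
    ExtKLR 𝕜 N C t n →ₐ[𝕜] (Module.End 𝕜 (PolySpace 𝕜 N n))ᵐᵒᵖ :=
  RingQuot.liftAlgHom 𝕜 ⟨freeAct 𝕜 N n, freeAct_eq_of_rel ht⟩

variable (ht : ∀ a b, extForm C a b = 0 → t a b = 1)

lemma klrAct_klrMk (a : FreeAlgebra 𝕜 (KLRGen (Fin N ⊕ Fin N) n)) :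
    klrAct ht (klrMk 𝕜 _ n (extForm C) t (fun _ => 1) (fun _ _ _ _ => 0) a) =
      freeAct 𝕜 N n a :=
  RingQuot.liftAlgHom_mkAlgHom_apply ..

lemma klrAct_mul (a b : ExtKLR 𝕜 N C t n) (f : PolySpace 𝕜 N n) :
    (klrAct ht (a * b)).unop f = (klrAct ht b).unop ((klrAct ht a).unop f) := by
  simp

lemma klrAct_eS (i : Fin n → Fin N ⊕ Fin N) (f : PolySpace 𝕜 N n) (ν : Fin n → Fin N) :
    (klrAct ht (eS 𝕜 N C t n i)).unop f ν = if Sum.inr ∘ ν = i then f ν else 0 := by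
  rw [eS, eQ, klrAct_klrMk, freeAct_Ef]

lemma klrAct_dotGen (j : Fin n) (f : PolySpace 𝕜 N n) (ν : Fin n → Fin N) :
    (klrAct ht (dotGen 𝕜 C t n j)).unop f ν = MvPolynomial.X j * f ν := by
  rw [dotGen, xQ, klrAct_klrMk, freeAct_Xf]

lemma klrAct_crossGen (j : Fin (n - 1)) (f : PolySpace 𝕜 N n) (ν : Fin n → Fin N) :
    (klrAct ht (crossGen 𝕜 C t n j)).unop f ν =
      if ν (lpos j) = ν (rpos j) then divDiff (lpos j) (rpos j) (lpos_ne_rpos j) (f ν)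
      else swapVars (lpos j) (rpos j) (f (ν ∘ Equiv.swap (lpos j) (rpos j))) := by
  rw [crossGen, pQ, klrAct_klrMk, freeAct_Pf]

lemma eS_mul_eS_of_ne {i i' : Fin n → Fin N ⊕ Fin N} (h : i ≠ i') :
    eS 𝕜 N C t n i * eS 𝕜 N C t n i' = 0 := by
  have := klrMk_eq_of_rel (KLRRel.ee (𝕜 := 𝕜) (B := extForm C) (t := t) (r := fun _ => 1)
    (s := fun _ _ _ _ => 0) i i')
  rwa [if_neg h, map_mul, map_zero] at this

variable {μ : Fin n → Fin N} {a : ExtKLR 𝕜 N C t n}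
  (ha : a * eS 𝕜 N C t n (Sum.inr ∘ μ) = a)
  (ha' : ∀ j, μ (lpos j) = μ (rpos j) → a * crossGen 𝕜 C t n j = 0)

include ha in
lemma polyMap_mul_eS (i : Fin n → Fin N ⊕ Fin N) (f : PolySpace 𝕜 N n) :
    (dashedRelations ht).polyMap μ a f * eS 𝕜 N C t n i =
      (dashedRelations ht).polyMap μ a (genAct 𝕜 N n (.e i) f) := by
  rw [DashedRelations.polyMap, DashedRelations.polyMap, Finset.sum_mul]
  refine Finset.sum_congr rfl fun ν _ => ?_
  simp only [genAct, LinearMap.coe_mk, AddHom.coe_mk]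
  have hE := (dashedRelations ht).transport_mul_commEval_mul_E ha ν (f ν)
  split_ifs with h
  · rw [← h, hE]
  · rw [← hE, mul_assoc, eS_mul_eS_of_ne h, mul_zero, map_zero, mul_zero]

include ha ha' in
lemma polyMap_mul (r : ExtKLR 𝕜 N C t n) (f : PolySpace 𝕜 N n) :
    (dashedRelations ht).polyMap μ a f * r =
      (dashedRelations ht).polyMap μ a ((klrAct ht r).unop f) := by
  obtain ⟨b, rfl⟩ := RingQuot.mkAlgHom_surjective 𝕜 _ r
  change _ * klrMk 𝕜 _ n (extForm C) t (fun _ => 1) (fun _ _ _ _ => 0) b =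
    DashedRelations.polyMap _ _ _ ((klrAct ht (klrMk 𝕜 _ n _ _ _ _ b)).unop f)
  rw [klrAct_klrMk]
  induction b using FreeAlgebra.induction generalizing f with
  | grade0 c =>
    rw [AlgHom.commutes, AlgHom.commutes, ← Algebra.commutes, ← Algebra.smul_def]
    simp [DashedRelations.polyMap, Finset.smul_sum]
  | grade1 g =>
    rw [freeAct, FreeAlgebra.lift_ι_apply, MulOpposite.unop_op]
    cases g with
    | e i => exact polyMap_mul_eS ht ha i f
    | x j => exact (dashedRelations ht).polyMap_mul_X j f
    | psi j => exact (dashedRelations ht).polyMap_mul_P ha ha' j f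
  | mul b c hb hc => rw [map_mul, ← mul_assoc, hb, hc, freeAct_mul]
  | add b c hb hc =>
    rw [map_add, mul_add, hb, hc]
    simp [DashedRelations.polyMap, mul_add, Finset.sum_add_distrib]

lemma polyMap_single (hμ : ∀ j, μ (lpos j) ≤ μ (rpos j)) (p : MvPolynomial (Fin n) 𝕜) :
    (dashedRelations ht).polyMap μ a (Pi.single μ p) =
      a * commEval (dotGen 𝕜 C t n) (dashedRelations ht).X_mul_X p := by
  rw [DashedRelations.polyMap, Finset.sum_eq_single μ, transport_of_sorted hμ, if_pos rfl,
    Pi.single_eq_same]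
  · intro ν _ h
    rw [Pi.single_eq_of_ne h, map_zero, mul_zero]
  · simp

include ha ha' in
/-- The `μ`-component of the right ideal generated by `a` consists of polynomial multiples. -/
lemma mul_mul_eS (hμ : ∀ j, μ (lpos j) ≤ μ (rpos j)) (r : ExtKLR 𝕜 N C t n) :
    a * r * eS 𝕜 N C t n (Sum.inr ∘ μ) = a * commEval (dotGen 𝕜 C t n)
      (dashedRelations ht).X_mul_X ((klrAct ht r).unop (Pi.single μ 1) μ) := by
  rw [← polyMap_single ht hμ, mul_assoc]
  conv_lhs => rw [← mul_one a, ← map_one (commEval (𝕜 := 𝕜) (dotGen 𝕜 C t n)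
    (dashedRelations ht).X_mul_X), ← polyMap_single ht hμ]
  rw [polyMap_mul ht ha ha', klrAct_mul]
  congr 1
  ext1 ν
  rw [klrAct_eS]
  split_ifs with h
  · rw [Sum.inr_injective.comp_left h, Pi.single_eq_same]
  · rw [Pi.single_eq_of_ne fun e => h (by rw [e])]

lemma klrAct_commEval (p : MvPolynomial (Fin n) 𝕜) (f : PolySpace 𝕜 N n) :
    (klrAct ht (commEval (dotGen 𝕜 C t n) (dashedRelations ht).X_mul_X p)).unop f =
      fun ν => p * f ν := by
  induction p using MvPolynomial.induction_on generalizing f with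
  | C c =>
    rw [← MvPolynomial.algebraMap_eq, AlgHom.commutes, AlgHom.commutes]
    ext1 ν
    simp [Algebra.smul_def]
  | add p q hp hq =>
    ext1 ν
    simp [hp, hq, add_mul]
  | mul_X p j hp =>
    ext1 ν
    rw [map_mul, klrAct_mul, hp, commEval_X, klrAct_dotGen]
    ring

include ha ha' in
/-- An element which is fixed by right multiplication with `e(μ)`, annihilated by the crossings
preserving `μ` and fixes the unit at `μ` is a primitive idempotent. -/
lemma primitive_of_klrAct_single (hμ : ∀ j, μ (lpos j) ≤ μ (rpos j))
    (h1 : (klrAct ht a).unop (Pi.single μ 1) = Pi.single μ 1) :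
    a ≠ 0 ∧ ¬ ∃ f g : ExtKLR 𝕜 N C t n, f ≠ 0 ∧ g ≠ 0 ∧ f * f = f ∧ g * g = g ∧
        f * g = 0 ∧ g * f = 0 ∧ a = f + g := by
  refine ⟨?_, ?_⟩
  · rintro rfl
    have := congrFun h1 μ
    simp at this
  · rintro ⟨f, g, hf, hg, hff, hgg, hfg, hgf, rfl⟩
    have key : ∀ r, (f + g) * r = r → r * (f + g) = r → ∃ p, r = (f + g) *
        commEval (𝕜 := 𝕜) (dotGen 𝕜 C t n) (dashedRelations ht).X_mul_X p := by
      intro r hr hr'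
      refine ⟨_, Eq.trans ?_ (mul_mul_eS ht ha ha' hμ r)⟩
      rw [hr, ← hr', mul_assoc, ha]
    obtain ⟨p, hp⟩ := key f (by rw [add_mul, hff, hgf, add_zero])
      (by rw [mul_add, hff, hfg, add_zero])
    obtain ⟨q, hq⟩ := key g (by rw [add_mul, hgg, hfg, zero_add])
      (by rw [mul_add, hgg, hgf, zero_add])
    have act : ∀ p : MvPolynomial (Fin n) 𝕜, (klrAct ht ((f + g) * commEval (dotGen 𝕜 C t n)
        (dashedRelations ht).X_mul_X p)).unop (Pi.single μ 1) = Pi.single μ p := by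
      intro p
      rw [klrAct_mul, h1, klrAct_commEval]
      ext1 ν
      by_cases h : ν = μ
      · subst h; simp
      · simp [h]
    have hfp : (klrAct ht f).unop (Pi.single μ 1) = Pi.single μ p := by
      conv_lhs => rw [hp]
      exact act p
    have hpe : (klrAct ht (f + g)).unop (Pi.single μ p) = Pi.single μ p := by
      rw [← hfp, ← klrAct_mul, mul_add, hff, hfg, add_zero]
    have hpq : (klrAct ht (f * g)).unop (Pi.single μ 1) μ = q * p := by
      conv_lhs => rw [klrAct_mul, hfp, hq, klrAct_mul, hpe, klrAct_commEval]
      simp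
    rw [hfg, map_zero, MulOpposite.unop_zero, LinearMap.zero_apply, Pi.zero_apply, eq_comm,
      mul_eq_zero] at hpq
    rcases hpq with h | h
    · exact hg (by rw [hq, h, map_zero, mul_zero])
    · exact hf (by rw [hp, h, map_zero, mul_zero])

end ExtendedKLR

section LongestWord

lemma succ_lt_of_mem_w0Word {a l : ℕ} (h : l ∈ w0Word a) : l + 1 < a := by
  simp only [w0Word, List.mem_flatMap, List.mem_range, List.mem_reverse] at h
  omega

lemma w0Word_succ (a : ℕ) : w0Word (a + 1) = w0Word a ++ (List.range a).reverse := by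
  simp [w0Word, List.range_succ, List.flatMap_append]

variable {A : Type} [Ring A] {e : A} {p : ℕ → A} {a : ℕ}
  (hc : ∀ l, l + 1 < a → Commute e (p l))
  (hsq : ∀ l, l + 1 < a → e * (p l * p l) = 0)
  (hbr : ∀ l, l + 2 < a → e * (p l * p (l + 1) * p l) = e * (p (l + 1) * p l * p (l + 1)))
  (hfar : ∀ k l, k + 1 < l → l + 1 < a → Commute (p l) (p k))

include hc hbr hfar in
lemma mul_prod_descending_mul_succ {k j : ℕ} (hk : k < a) (hj : j + 1 < k) :
    e * (((List.range k).reverse.map p).prod * p (j + 1)) =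
      e * (p j * ((List.range k).reverse.map p).prod) := by
  induction k with
  | zero => omega
  | succ k ih =>
    rw [List.range_succ, List.reverse_append, List.reverse_singleton, List.singleton_append,
      List.map_cons, List.prod_cons]
    have hck : e * p k = p k * e := (hc k hk).eq
    rcases Nat.lt_or_ge (j + 1) k with h | h
    · rw [mul_assoc, ← mul_assoc, hck, mul_assoc, ih (by omega) h, ← mul_assoc, ← hck, mul_assoc,
        ← mul_assoc (p k), (hfar j k h hk).eq, mul_assoc]
    · obtain rfl : k = j + 1 := by omega
      have hR : Commute ((List.range j).reverse.map p).prod (p (j + 1)) := by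
        refine (Commute.list_prod_right _ _ ?_).symm
        simp only [List.mem_map, List.mem_reverse, List.mem_range]
        rintro _ ⟨i, hi, rfl⟩
        exact hfar i (j + 1) (by omega) hk
      rw [List.range_succ, List.reverse_append, List.reverse_singleton, List.singleton_append,
        List.map_cons, List.prod_cons]
      have := congrArg (· * ((List.range j).reverse.map p).prod) (hbr j (by omega))
      simp only [mul_assoc] at this ⊢
      rw [hR.eq, this]

include hsq hc in
lemma mul_prod_descending_mul_zero {k : ℕ} (hk : k + 1 < a) :
    e * (((List.range (k + 1)).reverse.map p).prod * p 0) = 0 := by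
  have hR : Commute e ((List.map Nat.succ (List.range k)).reverse.map p).prod := by
    refine Commute.list_prod_right _ _ ?_
    simp only [List.mem_map, List.mem_reverse, List.mem_range]
    rintro _ ⟨_, ⟨i, hi, rfl⟩, rfl⟩
    exact hc _ (by simp; omega)
  rw [List.range_succ_eq_map, List.reverse_cons, List.map_append, List.prod_append,
    List.map_singleton, List.prod_singleton, mul_assoc, ← mul_assoc, hR.eq, mul_assoc,
    hsq 0 (by omega), mul_zero]

include hc hsq hbr hfar in
/-- The crossings of a longest word are annihilated by every crossing. -/
lemma mul_prod_w0Word_mul {b j : ℕ} (hb : b ≤ a) (hj : j + 1 < b) :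
    e * (((w0Word b).map p).prod * p j) = 0 := by
  induction b generalizing j with
  | zero => omega
  | succ b ih =>
    have hW : Commute e ((w0Word b).map p).prod := by
      refine Commute.list_prod_right _ _ ?_
      simp only [List.mem_map]
      rintro _ ⟨i, hi, rfl⟩
      have := succ_lt_of_mem_w0Word hi
      exact hc _ (by omega)
    rw [w0Word_succ, List.map_append, List.prod_append, mul_assoc, ← mul_assoc, hW.eq, mul_assoc]
    cases j with
    | zero =>
      obtain ⟨c, rfl⟩ : ∃ c, b = c + 1 := ⟨b - 1, by omega⟩
      rw [mul_prod_descending_mul_zero hc hsq (by omega), mul_zero]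
    | succ j =>
      rw [mul_prod_descending_mul_succ hc hbr hfar (by omega) (by omega), ← mul_assoc, ← hW.eq,
        mul_assoc, ← mul_assoc _ (p j), ← mul_assoc, ih (by omega) (by omega), zero_mul]

end LongestWord

section Blocks

variable {N : ℕ} {lam : Fin N → ℕ}

lemma psum_eq_of_append {i : Fin N} {L₁ L₂ : List (Fin N)}
    (h : List.finRange N = L₁ ++ i :: L₂) : psum N lam i = (L₁.map lam).sum := by
  have hs : (L₁ ++ i :: L₂).Pairwise (· < ·) := h ▸ List.pairwise_lt_finRange N
  simp only [List.pairwise_append, List.pairwise_cons, List.mem_cons] at hs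
  rw [psum, Fin.sum_univ_def, h, List.map_append, List.sum_append, List.map_cons, List.sum_cons,
    if_neg (lt_irrefl _), zero_add]
  have h1 : L₁.map (fun a => if a.val < i.val then lam a else 0) = L₁.map lam :=
    List.map_congr_left fun a ha => if_pos (hs.2.2 a ha i (Or.inl rfl))
  have h2 : L₂.map (fun a => if a.val < i.val then lam a else 0) = L₂.map fun _ => 0 :=
    List.map_congr_left fun a ha => if_neg (lt_asymm (hs.2.1.1 a ha))
  rw [h1, h2]
  simp

lemma exists_append_of_getElem_flatMap {α : Type} (f : α → ℕ) (L : List α) (l : ℕ)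
    (h : l < (L.flatMap fun i => List.replicate (f i) i).length) :
    ∃ L₁ i L₂, L = L₁ ++ i :: L₂ ∧ (L.flatMap fun i => List.replicate (f i) i)[l] = i ∧
      (L₁.map f).sum ≤ l ∧ l < (L₁.map f).sum + f i := by
  induction L generalizing l with
  | nil => simp at h
  | cons k L ih =>
    by_cases hl : l < f k
    · refine ⟨[], k, L, rfl, ?_, by simp, by simpa using hl⟩
      simp [hl]
    · have h' : l - f k < (L.flatMap fun i => List.replicate (f i) i).length := by
        rw [List.flatMap_cons, List.length_append, List.length_replicate] at h
        omega
      obtain ⟨L₁, i, L₂, rfl, h1, h2, h3⟩ := ih _ h'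
      refine ⟨k :: L₁, i, L₂, rfl, ?_, ?_, ?_⟩
      · refine Eq.trans ?_ h1
        simp only [List.flatMap_cons]
        rw [List.getElem_append_right (by simpa using hl)]
        simp
      · simp only [List.map_cons, List.sum_cons]; omega
      · simp only [List.map_cons, List.sum_cons]; omega

lemma psum_blockOf (l : Fin (mTot N lam)) :
    psum N lam (blockOf N lam l) ≤ l ∧ (l : ℕ) < psum N lam (blockOf N lam l) +
      lam (blockOf N lam l) := by
  obtain ⟨L₁, i, L₂, h, h1, h2, h3⟩ := exists_append_of_getElem_flatMap lam (List.finRange N) l l.2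
  have hi : blockOf N lam l = i := h1
  rw [hi, psum_eq_of_append h]
  exact ⟨h2, h3⟩

lemma psum_add_le_psum {i j : Fin N} (h : i < j) : psum N lam i + lam i ≤ psum N lam j := by
  have hi : lam i = ∑ a : Fin N, if a = i then lam a else 0 := by simp
  rw [psum, psum, hi, ← Finset.sum_add_distrib]
  refine Finset.sum_le_sum fun a _ => ?_
  rw [Fin.lt_def] at h
  split_ifs
  all_goals simp_all [Fin.ext_iff]
  all_goals omega

lemma psum_add_le_mTot (i : Fin N) : psum N lam i + lam i ≤ mTot N lam := by
  have hi : lam i = ∑ a : Fin N, if a = i then lam a else 0 := by simp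
  have hm : mTot N lam = ∑ a : Fin N, lam a := by
    rw [mTot, blockList, List.length_flatMap, Fin.sum_univ_def]
    simp
  rw [psum, hm, hi, ← Finset.sum_add_distrib]
  refine Finset.sum_le_sum fun a _ => ?_
  split_ifs <;> simp_all

lemma blockOf_eq {i : Fin N} {l : Fin (mTot N lam)} (h1 : psum N lam i ≤ l)
    (h2 : (l : ℕ) < psum N lam i + lam i) : blockOf N lam l = i := by
  have := psum_blockOf l
  rcases lt_trichotomy (blockOf N lam l) i with h | h | h
  · have := psum_add_le_psum (lam := lam) h
    omega
  · exact h
  · have := psum_add_le_psum (lam := lam) h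
    omega

lemma blockOf_mono {l l' : Fin (mTot N lam)} (h : l ≤ l') : blockOf N lam l ≤ blockOf N lam l' := by
  by_contra! hlt
  have := psum_add_le_psum (lam := lam) hlt
  have := psum_blockOf l
  have := psum_blockOf l'
  rw [Fin.le_def] at h
  omega

end Blocks

section NilHeckeBlock

variable {𝕜 : Type} [Field 𝕜] {N : ℕ} {C : CartanDatum (Fin N)}
  {t : Fin N ⊕ Fin N → Fin N ⊕ Fin N → 𝕜} {n : ℕ}

lemma Pn_of_lt {l : ℕ} (h : l < n - 1) : Pn 𝕜 N C t n l = crossGen 𝕜 C t n ⟨l, h⟩ :=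
  dif_pos h

lemma Pn_of_not_lt {l : ℕ} (h : ¬ l < n - 1) : Pn 𝕜 N C t n l = 1 :=
  dif_neg h

lemma Xn_of_lt {l : ℕ} (h : l < n) : Xn 𝕜 N C t n l = dotGen 𝕜 C t n ⟨l, h⟩ :=
  dif_pos h

lemma Xn_of_not_lt {l : ℕ} (h : ¬ l < n) : Xn 𝕜 N C t n l = 1 :=
  dif_neg h

/-- The colour sequence `μ` is constant on the `a` strand positions starting at `o`. -/
def ConstOn (μ : Fin n → Fin N) (o a : ℕ) : Prop :=
  ∀ j : Fin (n - 1), o ≤ j → (j : ℕ) + 1 < o + a → μ (lpos j) = μ (rpos j)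

variable (ht : ∀ a b, extForm C a b = 0 → t a b = 1)

include ht in
lemma eS_commute_Xn (μ : Fin n → Fin N) (l : ℕ) :
    Commute (eS 𝕜 N C t n (Sum.inr ∘ μ)) (Xn 𝕜 N C t n l) := by
  by_cases h : l < n
  · rw [Xn_of_lt h]
    exact ((dashedRelations ht).X_mul_E _ μ).symm
  · rw [Xn_of_not_lt h]
    exact Commute.one_right _

variable {μ : Fin n → Fin N} {o a : ℕ} (hμ : ConstOn μ o a)

include ht in
lemma eS_commute_crossGen {j : Fin (n - 1)} (h : μ (lpos j) = μ (rpos j)) :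
    Commute (eS 𝕜 N C t n (Sum.inr ∘ μ)) (crossGen 𝕜 C t n j) := by
  have := (dashedRelations (𝕜 := 𝕜) ht).P_mul_E j μ
  rw [comp_swap_eq h] at this
  exact this.symm

include ht hμ in
lemma eS_commute_Pn {l : ℕ} (hl : l + 1 < a) :
    Commute (eS 𝕜 N C t n (Sum.inr ∘ μ)) (Pn 𝕜 N C t n (o + l)) := by
  by_cases h : o + l < n - 1
  · rw [Pn_of_lt h]
    exact eS_commute_crossGen ht (hμ _ (by simp) (by simp; omega))
  · rw [Pn_of_not_lt h]
    exact Commute.one_right _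

include ht in
lemma eS_commute_dots : Commute (eS 𝕜 N C t n (Sum.inr ∘ μ))
    ((List.range a).map fun d => Xn 𝕜 N C t n (o + d) ^ (a - 1 - d)).prod := by
  refine Commute.list_prod_right _ _ ?_
  simp only [List.mem_map]
  rintro _ ⟨d, -, rfl⟩
  exact (eS_commute_Xn ht μ _).pow_right _

include ht hμ in
lemma eS_commute_enAt : Commute (eS 𝕜 N C t n (Sum.inr ∘ μ)) (enAt 𝕜 N C t n o a) := by
  refine (eS_commute_dots ht).mul_right (Commute.list_prod_right _ _ ?_)
  simp only [List.mem_map]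
  rintro _ ⟨l, hl, rfl⟩
  exact eS_commute_Pn ht hμ (succ_lt_of_mem_w0Word hl)

include ht hμ in
lemma eS_mul_enAt_mul_crossGen (ho : o + a ≤ n) {j : Fin (n - 1)} (hj : o ≤ j)
    (hj' : (j : ℕ) + 1 < o + a) :
    eS 𝕜 N C t n (Sum.inr ∘ μ) * enAt 𝕜 N C t n o a * crossGen 𝕜 C t n j = 0 := by
  have hR := dashedRelations (𝕜 := 𝕜) (n := n) ht
  have hlt : ∀ l, l + 1 < a → o + l < n - 1 := fun l hl => by omega
  have hc : ∀ l, l + 1 < a → Commute (eS 𝕜 N C t n (Sum.inr ∘ μ)) (Pn 𝕜 N C t n (o + l)) :=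
    fun l hl => eS_commute_Pn ht hμ hl
  obtain ⟨l, hl⟩ : ∃ l, (j : ℕ) = o + l := ⟨j - o, by omega⟩
  have hP : crossGen 𝕜 C t n j = Pn 𝕜 N C t n (o + l) := by
    rw [Pn_of_lt (by omega)]
    exact congrArg _ (Fin.ext hl)
  rw [enAt, ← mul_assoc, (eS_commute_dots ht).eq, mul_assoc, mul_assoc, hP,
    mul_prod_w0Word_mul (a := a) (p := fun l => Pn 𝕜 N C t n (o + l)) hc ?_ ?_ ?_ le_rfl
      (by omega), mul_zero]
  · intro l hl
    rw [((hc l hl).mul_right (hc l hl)).eq, Pn_of_lt (hlt l hl)]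
    exact (hR.P_sq _ μ).trans (if_pos (hμ _ (by simp) (by simp; omega)))
  · intro l hl
    have h0 := hc l (by omega)
    have h1 := hc (l + 1) (by omega)
    rw [((h0.mul_right h1).mul_right h0).eq, ((h1.mul_right h0).mul_right h1).eq,
      Pn_of_lt (hlt l (by omega)), Pn_of_lt (hlt (l + 1) (by omega))]
    exact hR.braid _ _ (by simp; omega) μ
  · intro k l hk hl
    rw [Pn_of_lt (hlt l hl), Pn_of_lt (hlt k (by omega))]
    exact hR.P_comm (Or.inr (by simp; omega))

include ht in
lemma enAt_commute_crossGen {j : Fin (n - 1)} (hj : (j : ℕ) + 1 < o ∨ o + a ≤ j) :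
    Commute (enAt 𝕜 N C t n o a) (crossGen 𝕜 C t n j) := by
  have hR := dashedRelations (𝕜 := 𝕜) (n := n) ht
  refine Commute.mul_left (Commute.list_prod_left _ _ ?_) (Commute.list_prod_left _ _ ?_)
  · simp only [List.mem_map, List.mem_range]
    rintro _ ⟨d, hd, rfl⟩
    refine Commute.pow_left ?_ _
    by_cases h : o + d < n
    · rw [Xn_of_lt h]
      exact (hR.P_mul_X j _ (by simp [lpos, Fin.ext_iff]; omega)
        (by simp [rpos, Fin.ext_iff]; omega)).symm
    · rw [Xn_of_not_lt h]
      exact Commute.one_left _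
  · simp only [List.mem_map]
    rintro _ ⟨l, hl, rfl⟩
    have := succ_lt_of_mem_w0Word hl
    by_cases h : o + l < n - 1
    · rw [Pn_of_lt h]
      exact hR.P_comm (by simp; omega)
    · rw [Pn_of_not_lt h]
      exact Commute.one_left _

end NilHeckeBlock

section Monomials

variable {𝕜 : Type} [Field 𝕜] {n : ℕ}

variable (𝕜 n) in
/-- The monomial whose exponent at the strand position `l` is `E l`. -/
def mono (E : ℕ → ℕ) : MvPolynomial (Fin n) 𝕜 :=
  ∏ l : Fin n, MvPolynomial.X l ^ E l

lemma mono_eq_one {E : ℕ → ℕ} (h : ∀ l, E l = 0) : mono 𝕜 n E = 1 := by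
  simp [mono, h]

lemma mono_eq_X_pow_mul {E E' : ℕ → ℕ} (j : Fin n) (k : ℕ) (h : E j = E' j + k)
    (h' : ∀ l ≠ (j : ℕ), E l = E' l) : mono 𝕜 n E = MvPolynomial.X j ^ k * mono 𝕜 n E' := by
  rw [mono, mono, ← Finset.mul_prod_erase _ _ (Finset.mem_univ j),
    ← Finset.mul_prod_erase _ _ (Finset.mem_univ j), h, pow_add, ← mul_assoc,
    mul_comm (MvPolynomial.X j ^ k)]
  congr 1
  refine Finset.prod_congr rfl fun l hl => ?_
  rw [h' l fun e => Finset.ne_of_mem_erase hl (Fin.ext e)]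

lemma swapVars_mono {E : ℕ → ℕ} {i j : Fin n} (h : E i = E j) :
    swapVars i j (mono 𝕜 n E) = mono 𝕜 n E := by
  rw [mono, map_prod, ← Equiv.prod_comp (Equiv.swap i j) fun l => MvPolynomial.X l ^ E l]
  refine Finset.prod_congr rfl fun l _ => ?_
  rw [map_pow, swapVars_X]
  congr 1
  rw [Equiv.swap_apply_def]
  split_ifs with h1 h2
  · rw [h1, h]
  · rw [h2, h]
  · rfl

lemma divDiff_mono {E E' : ℕ → ℕ} {i j : Fin n} (hij : i ≠ j) (h : E i = E' i + 1)
    (h' : ∀ l ≠ (i : ℕ), E l = E' l) (hE : E' i = E' j) :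
    divDiff i j hij (mono 𝕜 n E) = mono 𝕜 n E' := by
  apply divDiff_eq
  rw [mono_eq_X_pow_mul i 1 h h', map_mul, pow_one, swapVars_mono hE, swapVars_X,
    Equiv.swap_apply_left]
  ring

end Monomials

section UnitAction

variable {𝕜 : Type} [Field 𝕜] {N : ℕ} {C : CartanDatum (Fin N)}
  {t : Fin N ⊕ Fin N → Fin N ⊕ Fin N → 𝕜} {n : ℕ}
  (ht : ∀ a b, extForm C a b = 0 → t a b = 1) {μ : Fin n → Fin N}

lemma klrAct_eS_single (p : MvPolynomial (Fin n) 𝕜) :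
    (klrAct ht (eS 𝕜 N C t n (Sum.inr ∘ μ))).unop (Pi.single μ p) = Pi.single μ p := by
  ext1 ν
  rw [klrAct_eS]
  split_ifs with h
  · rfl
  · rw [Pi.single_eq_of_ne fun e => h (by rw [e])]

lemma klrAct_dotGen_pow_single (j : Fin n) (k : ℕ) (p : MvPolynomial (Fin n) 𝕜) :
    (klrAct ht (dotGen 𝕜 C t n j ^ k)).unop (Pi.single μ p) =
      Pi.single μ (MvPolynomial.X j ^ k * p) := by
  induction k with
  | zero => simp
  | succ k ih =>
    rw [pow_succ, klrAct_mul, ih]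
    ext1 ν
    rw [klrAct_dotGen]
    by_cases h : ν = μ
    · subst h
      simp only [Pi.single_eq_same]
      ring
    · rw [Pi.single_eq_of_ne h, Pi.single_eq_of_ne h, mul_zero]

lemma klrAct_crossGen_single {j : Fin (n - 1)} (hj : μ (lpos j) = μ (rpos j))
    (p : MvPolynomial (Fin n) 𝕜) :
    (klrAct ht (crossGen 𝕜 C t n j)).unop (Pi.single μ p) =
      Pi.single μ (divDiff (lpos j) (rpos j) (lpos_ne_rpos j) p) := by
  ext1 ν
  rw [klrAct_crossGen]
  by_cases h : ν = μ
  · subst h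
    simp [hj]
  · rw [Pi.single_eq_of_ne h, Pi.single_eq_of_ne h, map_zero]
    split_ifs with h'
    · rfl
    · rw [Pi.single_eq_of_ne, map_zero]
      rintro rfl
      simp at hj
      exact h' hj.symm

variable {o a : ℕ}

lemma klrAct_dots_single (ho : o + a ≤ n) (e : ℕ → ℕ) :
    (klrAct ht ((List.range a).map fun d => Xn 𝕜 N C t n (o + d) ^ e d).prod).unop
        (Pi.single μ 1) =
      Pi.single μ (mono 𝕜 n fun l => if o ≤ l ∧ l < o + a then e (l - o) else 0) := by
  induction a with
  | zero =>
    rw [mono_eq_one]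
    · simp
    · intro l
      rw [if_neg (by omega)]
  | succ a ih =>
    rw [List.range_succ, List.map_append, List.prod_append, klrAct_mul, ih (by omega),
      List.map_singleton, List.prod_singleton, Xn_of_lt (by omega), klrAct_dotGen_pow_single]
    congr 1
    refine (mono_eq_X_pow_mul _ _ ?_ ?_).symm
    · simp
    · intro l hl
      simp only at hl
      split_ifs <;> first | rfl | omega

variable (hμ : ConstOn μ o a) (ho : o + a ≤ n)

include hμ ho in
lemma klrAct_descending_single {k j : ℕ} (hk : k < a) (hj : j ≤ k) :
    (klrAct ht ((List.range j).reverse.map fun l => Pn 𝕜 N C t n (o + l)).prod).unop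
        (Pi.single μ (mono 𝕜 n fun l =>
          if l < o then 0 else if l < o + j then a - k else a - 1 - max k (l - o))) =
      Pi.single μ (mono 𝕜 n fun l => if l < o then 0 else a - 1 - max k (l - o)) := by
  induction j with
  | zero =>
    simp only [List.range_zero, List.reverse_nil, List.map_nil, List.prod_nil, map_one,
      MulOpposite.unop_one, Module.End.one_apply]
    congr 2
    ext1 l
    split_ifs <;> first | rfl | omega
  | succ j ih =>
    rw [List.range_succ, List.reverse_append, List.reverse_singleton, List.singleton_append,
      List.map_cons, List.prod_cons, klrAct_mul, Pn_of_lt (by omega),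
      klrAct_crossGen_single ht (hμ _ (by simp) (by simp; omega)), ← ih (by omega)]
    congr 2
    apply divDiff_mono
    · simp only [lpos, Fin.castLE_mk]
      grind
    · intro l hl
      simp only [lpos, Fin.castLE_mk] at hl
      split_ifs <;> omega
    · simp only [lpos, rpos, Fin.castLE_mk]
      grind

include hμ ho in
lemma klrAct_w0Word_single {b : ℕ} (hb : b ≤ a) :
    (klrAct ht ((w0Word b).map fun l => Pn 𝕜 N C t n (o + l)).prod).unop
        (Pi.single μ (mono 𝕜 n fun l => if l < o then 0 else a - 1 - (l - o))) =
      Pi.single μ (mono 𝕜 n fun l => if l < o then 0 else a - 1 - max (b - 1) (l - o)) := by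
  induction b with
  | zero => simp [w0Word]
  | succ b ih =>
    rw [w0Word_succ, List.map_append, List.prod_append, klrAct_mul, ih (by omega),
      Nat.add_sub_cancel, ← klrAct_descending_single ht hμ ho (show b < a by omega) le_rfl]
    congr 3
    ext1 l
    split_ifs <;> omega

include hμ ho in
lemma klrAct_enAt_single :
    (klrAct ht (enAt 𝕜 N C t n o a)).unop (Pi.single μ 1) = Pi.single μ 1 := by
  rw [enAt, klrAct_mul, klrAct_dots_single ht ho]
  refine Eq.trans ?_ ((klrAct_w0Word_single ht hμ ho le_rfl).trans ?_)
  · congr 3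
    ext1 l
    split_ifs <;> omega
  · rw [mono_eq_one]
    intro l
    split_ifs <;> omega

end UnitAction

section ThickIdempotent

variable {𝕜 : Type} [Field 𝕜] {N : ℕ} {C : CartanDatum (Fin N)}
  {t : Fin N ⊕ Fin N → Fin N ⊕ Fin N → 𝕜} {lam : Fin N → ℕ}

lemma constOn_blockOf (i : Fin N) : ConstOn (blockOf N lam) (0 + psum N lam i) (lam i) := by
  intro j hj hj'
  rw [blockOf_eq (i := i), blockOf_eq (i := i)]
  all_goals simp only [lpos, rpos, Fin.val_castLE]; omega

variable (ht : ∀ a b, extForm C a b = 0 → t a b = 1)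

include ht in
lemma thickE_mul_eS : thickE 𝕜 N C t lam * eS 𝕜 N C t (mTot N lam) (Sum.inr ∘ blockOf N lam) =
    thickE 𝕜 N C t lam := by
  have hc : Commute (eS 𝕜 N C t (mTot N lam) (Sum.inr ∘ blockOf N lam))
      (nilProd 𝕜 N C t lam (mTot N lam) 0) := by
    refine Commute.list_prod_right _ _ ?_
    simp only [List.mem_map]
    rintro _ ⟨i, -, rfl⟩
    exact eS_commute_enAt ht (constOn_blockOf i)
  change eS 𝕜 N C t _ (Sum.inr ∘ blockOf N lam) * _ * _ = eS 𝕜 N C t _ (Sum.inr ∘ _) * _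
  rw [mul_assoc, ← hc.eq, ← mul_assoc, (dashedRelations ht).E_mul_E]

include ht in
lemma thickE_mul_crossGen {j : Fin (mTot N lam - 1)}
    (hj : blockOf N lam (lpos j) = blockOf N lam (rpos j)) :
    thickE 𝕜 N C t lam * crossGen 𝕜 C t (mTot N lam) j = 0 := by
  set i := blockOf N lam (lpos j) with hi
  have h1 := (psum_blockOf (lpos j)).1
  have h2 := (psum_blockOf (rpos j)).2
  rw [← hj] at h2
  rw [← hi] at h1
  simp only [lpos, rpos, Fin.val_castLE] at h1 h2
  obtain ⟨L₁, L₂, hL⟩ := List.append_of_mem (List.mem_finRange i)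
  have hnd : (L₁ ++ i :: L₂).Nodup := hL ▸ List.nodup_finRange N
  have hA : Commute (eS 𝕜 N C t (mTot N lam) (Sum.inr ∘ blockOf N lam))
      (L₁.map fun k => enAt 𝕜 N C t (mTot N lam) (0 + psum N lam k) (lam k)).prod := by
    refine Commute.list_prod_right _ _ ?_
    simp only [List.mem_map]
    rintro _ ⟨k, -, rfl⟩
    exact eS_commute_enAt ht (constOn_blockOf k)
  have hB : Commute (L₂.map fun k => enAt 𝕜 N C t (mTot N lam) (0 + psum N lam k) (lam k)).prod
      (crossGen 𝕜 C t (mTot N lam) j) := by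
    refine Commute.list_prod_left _ _ ?_
    simp only [List.mem_map]
    rintro _ ⟨k, hk, rfl⟩
    have hki : i ≠ k := fun e => (List.nodup_cons.mp hnd.of_append_right).1 (e ▸ hk)
    refine enAt_commute_crossGen ht ?_
    rcases hki.lt_or_gt with h | h
    · have := psum_add_le_psum (lam := lam) h
      omega
    · have := psum_add_le_psum (lam := lam) h
      omega
  have hm := psum_add_le_mTot (lam := lam) i
  change eS 𝕜 N C t _ (Sum.inr ∘ blockOf N lam) * _ * _ = 0
  rw [nilProd, hL, List.map_append, List.prod_append, List.map_cons, List.prod_cons, ← mul_assoc,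
    hA.eq, mul_assoc, mul_assoc, mul_assoc, hB.eq, ← mul_assoc (enAt ..), ← mul_assoc (eS ..),
    ← mul_assoc (eS ..), eS_mul_enAt_mul_crossGen ht (constOn_blockOf i) (by omega) (by omega)
      (by omega), zero_mul, mul_zero]

lemma klrAct_thickE_single : (klrAct ht (thickE 𝕜 N C t lam)).unop
    (Pi.single (blockOf N lam) 1) = Pi.single (blockOf N lam) 1 := by
  have hL : ∀ L : List (Fin N), (klrAct ht (L.map fun i =>
      enAt 𝕜 N C t (mTot N lam) (0 + psum N lam i) (lam i)).prod).unop
        (Pi.single (blockOf N lam) 1) = Pi.single (blockOf N lam) 1 := by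
    intro L
    induction L with
    | nil => simp
    | cons i L ih =>
      have := psum_add_le_mTot (lam := lam) i
      rw [List.map_cons, List.prod_cons, klrAct_mul,
        klrAct_enAt_single ht (constOn_blockOf i) (by omega), ih]
  rw [thickE, klrAct_mul]
  refine (congrArg _ (klrAct_eS_single ht 1)).trans (hL _)

end ThickIdempotent

/-- the thick idempotent `e_{λ_k}` is a primitive idempotent of
`R_m(Q̄_{C̃})`: it is nonzero and is not the sum of two nonzero orthogonal
idempotents. -/
theorem thickE_primitive (𝕜 : Type) [Field 𝕜] (N : ℕ) (C : CartanDatum (Fin N))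
    (t : Fin N ⊕ Fin N → Fin N ⊕ Fin N → 𝕜)
    (ht0 : ∀ a b, t a b ≠ 0)
    (ht1 : ∀ k : Fin N, t (Sum.inr k) (Sum.inl k) = -1)
    (ht2 : ∀ k : Fin N, t (Sum.inl k) (Sum.inr k) = 1)
    (ht3 : ∀ a b, extForm C a b = 0 → t a b = 1)
    (ht4 : ∀ a, t a a = 1)
    (lam : Fin N → ℕ) :
    thickE 𝕜 N C t lam ≠ 0 ∧
    ¬ ∃ f g : ExtKLR 𝕜 N C t (mTot N lam), f ≠ 0 ∧ g ≠ 0 ∧ f * f = f ∧ g * g = g ∧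
        f * g = 0 ∧ g * f = 0 ∧ thickE 𝕜 N C t lam = f + g := by
  exact primitive_of_klrAct_single ht3 (thickE_mul_eS ht3) (fun _ => thickE_mul_crossGen ht3)
    (fun j => blockOf_mono (lpos_lt_rpos j).le) (klrAct_thickE_single ht3)

end
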